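/- Let G be a finite simple graph, let H be a subgraph of G, and let q ∈ (1,∞). Suppose that either (a) q = 2 and H has at least two vertices, or (b) q ≠ 2 and H has at least four vertices. Then the following are equivalent: (i) H is relatively rigid in G with respect to (ℝ²,‖·‖_q), i.e. for every generic placement p of G in (ℝ²,‖·‖_q) no non-trivial infinitesimal flex of (H,p) extends to an infinitesimal flex of (G,p); (ii) H has a rigid container in G, i.e. there exists a subgraph H' of G containing H such that H' is rigid in (ℝ²,‖·‖_q). -/

import Mathlib

open Asymptotics Filter Topology Set

open scoped Classical

noncomputable section

namespace RigidityPaper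

variable {V X E : Type}

/-- `p` is a placement of the graph `G`: adjacent vertices are placed at distinct points. -/
def IsPlacement (G : SimpleGraph V) (p : V → X) : Prop :=
  ∀ ⦃v w⦄, G.Adj v w → p v ≠ p w

section NormedSpace

variable [NormedAddCommGroup X] [NormedSpace ℝ X]

/-- `u` is an infinitesimal flex of the framework `(G,p)` in the normed space `X`. -/
def IsFlex (G : SimpleGraph V) (p u : V → X) : Prop :=
  ∀ ⦃v w⦄, G.Adj v w →
    (fun t : ℝ => ‖(p v + t • u v) - (p w + t • u w)‖ - ‖p v - p w‖)
      =o[𝓝 (0 : ℝ)] (fun t : ℝ => t)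

/-- A continuous rigid motion of the normed space `X`. -/
def IsContRigidMotion (Γ : X → ℝ → X) : Prop :=
  (∀ t ∈ Icc (-1 : ℝ) 1, Isometry (fun x => Γ x t)) ∧
    (∀ x, ContinuousOn (Γ x) (Icc (-1 : ℝ) 1)) ∧ ∀ x, Γ x 0 = x

/-- An infinitesimal rigid motion of the normed space `X`. -/
def IsInfRigidMotion (γ : X → X) : Prop :=
  ∃ Γ, IsContRigidMotion Γ ∧ ∀ x, HasDerivWithinAt (Γ x) (γ x) (Icc (-1 : ℝ) 1) 0

/-- `u` is a trivial (infinitesimal) flex on the vertex set `S`. -/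
def IsTrivialOn (p : V → X) (S : Set V) (u : V → X) : Prop :=
  ∃ γ, IsInfRigidMotion γ ∧ ∀ v ∈ S, u v = γ (p v)

/-- The framework `(G,p)` is infinitesimally rigid. -/
def InfRigid (G : SimpleGraph V) (p : V → X) : Prop :=
  ∀ u, IsFlex G p u → IsTrivialOn p univ u

end NormedSpace

/-- A tower of finite subgraphs of `G`. -/
structure Tower (G : SimpleGraph V) where
  seq : ℕ → G.Subgraph
  mono : ∀ k, seq k ≤ seq (k + 1)
  finite : ∀ k, (seq k).verts.Finite

variable {G : SimpleGraph V}

/-- A tower is vertex-complete if its vertex sets exhaust the vertices of `G`. -/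
def VertexComplete (T : Tower G) : Prop := (⋃ k, (T.seq k).verts) = univ

/-- A tower is edge-complete if its edges exhaust the edges of `G`. -/
def EdgeComplete (T : Tower G) : Prop := ∀ ⦃v w⦄, G.Adj v w → ∃ k, (T.seq k).Adj v w

section NormedSpace

variable [NormedAddCommGroup X] [NormedSpace ℝ X]

/-- The flex cancellation property of a tower of frameworks: every non-trivial
infinitesimal flex of the `k`-th framework fails to extend to some later framework. -/
def FlexCancel (T : Tower G) (p : V → X) : Prop :=
  ∀ k u, IsFlex (T.seq k).spanningCoe p u → ¬ IsTrivialOn p (T.seq k).verts u →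
    ∃ m, k < m ∧
      ¬ ∃ u', IsFlex (T.seq m).spanningCoe p u' ∧ ∀ v ∈ (T.seq k).verts, u' v = u v

/-- A tower of frameworks is relatively infinitesimally rigid: no non-trivial
infinitesimal flex of the `k`-th framework extends to the `(k+1)`-st framework. -/
def RelRigidTower (T : Tower G) (p : V → X) : Prop :=
  ∀ k u, IsFlex (T.seq k).spanningCoe p u →
    (∃ u', IsFlex (T.seq (k + 1)).spanningCoe p u' ∧ ∀ v ∈ (T.seq k).verts, u' v = u v) →
    IsTrivialOn p (T.seq k).verts u

/-- The subframework on the subgraph `H` is infinitesimally rigid. -/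
def SubInfRigid (H : G.Subgraph) (p : V → X) : Prop :=
  ∀ u, IsFlex H.spanningCoe p u → IsTrivialOn p H.verts u

/-- The framework `(G,p)` is sequentially infinitesimally rigid. -/
def SeqInfRigid (G : SimpleGraph V) (p : V → X) : Prop :=
  ∃ T : Tower G, VertexComplete T ∧ ∀ k, SubInfRigid (T.seq k) p

end NormedSpace

/-! ### The `ℓ^q` norms on `ℝ^d` -/

/-- The `ℓ^q` norm on `ℝ^d`. -/
def qnorm (q : ℝ) {d : ℕ} (x : Fin d → ℝ) : ℝ := (∑ i, |x i| ^ q) ^ (1 / q)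

/-- `u` is an infinitesimal flex of `(G,p)` in `(ℝ^d, ‖·‖_q)`. -/
def IsQFlex (q : ℝ) {d : ℕ} (G : SimpleGraph V) (p u : V → Fin d → ℝ) : Prop :=
  ∀ ⦃v w⦄, G.Adj v w →
    (fun t : ℝ => qnorm q ((p v + t • u v) - (p w + t • u w)) - qnorm q (p v - p w))
      =o[𝓝 (0 : ℝ)] (fun t : ℝ => t)

/-- A continuous rigid motion of `(ℝ^d, ‖·‖_q)`. -/
def IsQContRigidMotion (q : ℝ) {d : ℕ} (Γ : (Fin d → ℝ) → ℝ → Fin d → ℝ) : Prop :=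
  (∀ t ∈ Icc (-1 : ℝ) 1, ∀ x y, qnorm q (Γ x t - Γ y t) = qnorm q (x - y)) ∧
    (∀ x, ContinuousOn (Γ x) (Icc (-1 : ℝ) 1)) ∧ ∀ x, Γ x 0 = x

/-- An infinitesimal rigid motion of `(ℝ^d, ‖·‖_q)`. -/
def IsQInfRigidMotion (q : ℝ) {d : ℕ} (γ : (Fin d → ℝ) → Fin d → ℝ) : Prop :=
  ∃ Γ, IsQContRigidMotion q Γ ∧ ∀ x, HasDerivWithinAt (Γ x) (γ x) (Icc (-1 : ℝ) 1) 0

/-- `u` is a trivial flex on the vertex set `S`, for the `ℓ^q` norm. -/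
def IsQTrivialOn (q : ℝ) {d : ℕ} (p : V → Fin d → ℝ) (S : Set V) (u : V → Fin d → ℝ) : Prop :=
  ∃ γ, IsQInfRigidMotion q γ ∧ ∀ v ∈ S, u v = γ (p v)

/-- The framework `(G,p)` is infinitesimally rigid in `(ℝ^d, ‖·‖_q)`. -/
def QInfRigid (q : ℝ) {d : ℕ} (G : SimpleGraph V) (p : V → Fin d → ℝ) : Prop :=
  ∀ u, IsQFlex q G p u → IsQTrivialOn q p univ u

/-- The subframework on the subgraph `H` is infinitesimally rigid in `(ℝ^d, ‖·‖_q)`. -/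
def QSubInfRigid (q : ℝ) {d : ℕ} (H : G.Subgraph) (p : V → Fin d → ℝ) : Prop :=
  ∀ u, IsQFlex q H.spanningCoe p u → IsQTrivialOn q p H.verts u

/-! ### The rigidity matrix, regular and generic placements -/

/-- The entry `sgn(a-b)|a-b|^{q-1}` of the rigidity matrix. -/
def rigidityCoef (q : ℝ) (a b : ℝ) : ℝ := Real.sign (a - b) * |a - b| ^ (q - 1)

/-- The row of the rigidity matrix `R_q(G,p)` corresponding to the (oriented) edge `vw`,
regarded as a vector in `ℝ^{V × d}`. -/
def rigidityRow (q : ℝ) {d : ℕ} (p : V → Fin d → ℝ) (v w : V) : V × Fin d → ℝ :=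
  fun x =>
    (if x.1 = v then rigidityCoef q (p v x.2) (p w x.2) else 0) -
      (if x.1 = w then rigidityCoef q (p v x.2) (p w x.2) else 0)

/-- The rank of the rigidity matrix `R_q(G,p)`, i.e. the dimension of its row space. -/
def rigidityRank (q : ℝ) {d : ℕ} (G : SimpleGraph V) (p : V → Fin d → ℝ) : ℕ :=
  Module.finrank ℝ
    (Submodule.span ℝ {r : V × Fin d → ℝ | ∃ v w, G.Adj v w ∧ r = rigidityRow q p v w})

/-- `(G,p)` is a regular framework in `(ℝ^d, ‖·‖_q)`: the rank of the rigidity matrix is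
maximal at `p` over all placements of `G`. -/
def IsRegular (q : ℝ) {d : ℕ} (G : SimpleGraph V) (p : V → Fin d → ℝ) : Prop :=
  IsPlacement G p ∧
    ∀ x : V → Fin d → ℝ, IsPlacement G x → rigidityRank q G x ≤ rigidityRank q G p

/-- `p` restricts on `W` to a generic placement: it is injective on `W` (a placement of the
complete graph on `W`) and every subframework of the complete graph on `W` is regular. -/
def GenericOn (q : ℝ) {d : ℕ} (p : V → Fin d → ℝ) (W : Set V) : Prop :=
  InjOn p W ∧ ∀ W' : Set V, W' ⊆ W → ∀ H : SimpleGraph W', IsRegular q H (fun x : W' => p x.1)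

/-- `p` is a generic placement in `(ℝ^d, ‖·‖_q)`: its restriction to every finite set of
vertices is generic. -/
def IsGeneric (q : ℝ) {d : ℕ} (p : V → Fin d → ℝ) : Prop :=
  ∀ W : Set V, W.Finite → GenericOn q p W

/-- The graph `G` is rigid in `(ℝ^d, ‖·‖_q)`: every generic placement is infinitesimally
rigid. -/
def Rigid (q : ℝ) (d : ℕ) (G : SimpleGraph V) : Prop :=
  ∀ p : V → Fin d → ℝ, IsGeneric q p → QInfRigid q G p

/-- The graph `G` is sequentially rigid in `(ℝ^d, ‖·‖_q)`: every generic placement is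
sequentially infinitesimally rigid. -/
def SeqRigid (q : ℝ) (d : ℕ) (G : SimpleGraph V) : Prop :=
  ∀ p : V → Fin d → ℝ, IsGeneric q p →
    ∃ T : Tower G, VertexComplete T ∧ ∀ k, QSubInfRigid q (T.seq k) p

/-- The graph `G` is minimally rigid in `(ℝ^d, ‖·‖_q)`. -/
def MinRigid (q : ℝ) (d : ℕ) (G : SimpleGraph V) : Prop :=
  Rigid q d G ∧
    ∀ p : V → Fin d → ℝ, IsGeneric q p → ∀ ⦃v w⦄, G.Adj v w →
      ¬ QInfRigid q (G.deleteEdges {s(v, w)}) p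

/-! ### Continuous rigidity in `(ℝ^d, ‖·‖_q)` -/

/-- `α` is a continuous flex of `(G,p)` in `(ℝ^d, ‖·‖_q)`. -/
def IsQContFlex (q : ℝ) {d : ℕ} (G : SimpleGraph V) (p : V → Fin d → ℝ)
    (α : V → ℝ → Fin d → ℝ) : Prop :=
  (∀ v, ContinuousOn (α v) (Icc (-1 : ℝ) 1)) ∧ (∀ v, α v 0 = p v) ∧
    ∀ ⦃v w⦄, G.Adj v w → ∀ t ∈ Icc (-1 : ℝ) 1, qnorm q (α v t - α w t) = qnorm q (p v - p w)

/-- `(G,p)` is continuously rigid in `(ℝ^d, ‖·‖_q)`: every continuous flex is trivial,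
that is, derived from a continuous rigid motion. -/
def QContRigid (q : ℝ) {d : ℕ} (G : SimpleGraph V) (p : V → Fin d → ℝ) : Prop :=
  ∀ α, IsQContFlex q G p α →
    ∃ Γ, IsQContRigidMotion q Γ ∧ ∀ v, ∀ t ∈ Icc (-1 : ℝ) 1, α v t = Γ (p v) t

/-! ### Sparsity counts -/

/-- A subgraph `H` is `(k,l)`-sparse. -/
def SubSparse (k l : ℕ) (H : G.Subgraph) : Prop :=
  ∀ H' : G.Subgraph, H' ≤ H → 2 ≤ H'.verts.ncard →
    (H'.edgeSet.ncard : ℤ) ≤ (k * H'.verts.ncard : ℤ) - l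

/-- A subgraph `H` is `(k,l)`-tight. -/
def SubTight (k l : ℕ) (H : G.Subgraph) : Prop :=
  SubSparse k l H ∧ (H.edgeSet.ncard : ℤ) = (k * H.verts.ncard : ℤ) - l

/-- A simple graph `G` (on its whole vertex type) is `(k,l)`-sparse. -/
def GraphSparse (k l : ℕ) (G : SimpleGraph V) : Prop :=
  ∀ H : G.Subgraph, 2 ≤ H.verts.ncard →
    (H.edgeSet.ncard : ℤ) ≤ (k * H.verts.ncard : ℤ) - l

/-! ### Graph moves -/

/-- Henneberg vertex extension move of degree 2: adjoin a new vertex `v` together with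
edges to two distinct existing vertices. -/
def HennVertexMove (H H' : (⊤ : SimpleGraph V).Subgraph) : Prop :=
  ∃ v v₁ v₂, v ∉ H.verts ∧ v₁ ∈ H.verts ∧ v₂ ∈ H.verts ∧ v₁ ≠ v₂ ∧
    H'.verts = insert v H.verts ∧
    ∀ a b, H'.Adj a b ↔
      (H.Adj a b ∨ (a = v ∧ (b = v₁ ∨ b = v₂)) ∨ (b = v ∧ (a = v₁ ∨ a = v₂)))

/-- Henneberg edge move of degree 2: remove an edge `v₁v₂` and adjoin a new vertex `v`
together with edges to `v₁`, `v₂` and a third existing vertex `v₃`. -/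
def HennEdgeMove (H H' : (⊤ : SimpleGraph V).Subgraph) : Prop :=
  ∃ v v₁ v₂ v₃, v ∉ H.verts ∧ v₁ ∈ H.verts ∧ v₂ ∈ H.verts ∧ v₃ ∈ H.verts ∧
    H.Adj v₁ v₂ ∧ v₃ ≠ v₁ ∧ v₃ ≠ v₂ ∧
    H'.verts = insert v H.verts ∧
    ∀ a b, H'.Adj a b ↔
      ((H.Adj a b ∧ ¬((a = v₁ ∧ b = v₂) ∨ (a = v₂ ∧ b = v₁))) ∨
        (a = v ∧ (b = v₁ ∨ b = v₂ ∨ b = v₃)) ∨ (b = v ∧ (a = v₁ ∨ a = v₂ ∨ a = v₃)))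

/-- Vertex-to-`K₄` move: a vertex `w₀` is chosen, three new vertices `w₁,w₂,w₃` are
adjoined together with all edges among `{w₀,w₁,w₂,w₃}`, and every edge `xw₀` is either
kept or replaced by an edge `x(f x)` with `f x ∈ {w₀,w₁,w₂,w₃}`. -/
def VertexToK4Move (H H' : (⊤ : SimpleGraph V).Subgraph) : Prop :=
  ∃ w₀ w₁ w₂ w₃, w₀ ∈ H.verts ∧ w₁ ∉ H.verts ∧ w₂ ∉ H.verts ∧ w₃ ∉ H.verts ∧
    w₁ ≠ w₂ ∧ w₁ ≠ w₃ ∧ w₂ ≠ w₃ ∧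
    ∃ f : V → V, (∀ x, f x = w₀ ∨ f x = w₁ ∨ f x = w₂ ∨ f x = w₃) ∧
      H'.verts = insert w₁ (insert w₂ (insert w₃ H.verts)) ∧
      ∀ a b, H'.Adj a b ↔
        ((H.Adj a b ∧ a ≠ w₀ ∧ b ≠ w₀) ∨
          (∃ x, H.Adj x w₀ ∧ ((a = x ∧ b = f x) ∨ (b = x ∧ a = f x))) ∨
          (a ∈ ({w₀, w₁, w₂, w₃} : Set V) ∧ b ∈ ({w₀, w₁, w₂, w₃} : Set V) ∧ a ≠ b))

/-- Vertex-to-4-cycle move: a vertex `v` with neighbours `v₁,v₂` is chosen, a new vertex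
`v₀` is adjoined together with the edges `v₀v₁`, `v₀v₂`, and every other edge `vw` is
either kept or replaced by the edge `v₀w`. -/
def VertexTo4CycleMove (H H' : (⊤ : SimpleGraph V).Subgraph) : Prop :=
  ∃ v v₀ v₁ v₂, v ∈ H.verts ∧ v₀ ∉ H.verts ∧ v₁ ≠ v₂ ∧
    H.Adj v v₁ ∧ H.Adj v v₂ ∧
    ∃ f : V → V, (∀ x, f x = v ∨ f x = v₀) ∧
      H'.verts = insert v₀ H.verts ∧
      ∀ a b, H'.Adj a b ↔
        ((H.Adj a b ∧ a ≠ v ∧ b ≠ v) ∨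
          ((a = v ∨ a = v₀) ∧ (b = v₁ ∨ b = v₂)) ∨
          ((b = v ∨ b = v₀) ∧ (a = v₁ ∨ a = v₂)) ∨
          (∃ w, H.Adj v w ∧ w ≠ v₁ ∧ w ≠ v₂ ∧ ((a = f w ∧ b = w) ∨ (b = f w ∧ a = w))))

/-! ### Multigraphs -/

/-- `(V',E')` is a subgraph of the multigraph with edge-endpoint map `ends`. -/
def MGSubgraph (ends : E → Sym2 V) (V' : Set V) (E' : Set E) : Prop :=
  ∀ e ∈ E', ∀ v ∈ ends e, v ∈ V'

/-- The (multigraph) subgraph `(V',E')` is `(k,l)`-sparse. -/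
def MGSparseOn (k l : ℕ) (ends : E → Sym2 V) (V' : Set V) (E' : Set E) : Prop :=
  ∀ (V'' : Set V) (E'' : Set E), V'' ⊆ V' → E'' ⊆ E' → MGSubgraph ends V'' E'' →
    2 ≤ V''.ncard → (E''.ncard : ℤ) ≤ (k * V''.ncard : ℤ) - l

/-- The (multigraph) subgraph `(V',E')` is `(k,l)`-tight. -/
def MGTightOn (k l : ℕ) (ends : E → Sym2 V) (V' : Set V) (E' : Set E) : Prop :=
  MGSparseOn k l ends V' E' ∧ (E'.ncard : ℤ) = (k * V'.ncard : ℤ) - l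

/-- The degree of a vertex in a loopless multigraph. -/
def mgDeg (ends : E → Sym2 V) (v : V) : ℕ := {e | v ∈ ends e}.ncard

section helpers
variable {V : Type}

/-! ### Linear algebra of edge constraints -/

def phi (q s : ℝ) : ℝ := Real.sign s * |s| ^ (q - 1)

lemma rigidityCoef_eq (q a b : ℝ) : rigidityCoef q a b = phi q (a - b) := rfl

lemma phi_zero (q : ℝ) : phi q 0 = 0 := by simp [phi]

lemma phi_one (q : ℝ) : phi q 1 = 1 := by simp [phi, Real.sign_of_pos]

lemma phi_neg (q s : ℝ) : phi q (-s) = - phi q s := by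
  simp [phi, Real.sign_neg]

lemma phi_of_pos (q : ℝ) {s : ℝ} (hs : 0 < s) : phi q s = s ^ (q - 1) := by
  simp [phi, Real.sign_of_pos hs, abs_of_pos hs]

lemma phi_mul (q s t : ℝ) : phi q (s * t) = phi q s * phi q t := by
  unfold phi
  rw [abs_mul, Real.mul_rpow (abs_nonneg _) (abs_nonneg _)]
  have : Real.sign (s * t) = Real.sign s * Real.sign t := by
    rcases lt_trichotomy s 0 with hs | hs | hs <;> rcases lt_trichotomy t 0 with ht | ht | ht
    · rw [Real.sign_of_neg hs, Real.sign_of_neg ht, Real.sign_of_pos (mul_pos_of_neg_of_neg hs ht)]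
      norm_num
    · simp [ht]
    · rw [Real.sign_of_neg hs, Real.sign_of_pos ht, Real.sign_of_neg (mul_neg_of_neg_of_pos hs ht)]
      norm_num
    · simp [hs]
    · simp [hs]
    · simp [hs]
    · rw [Real.sign_of_pos hs, Real.sign_of_neg ht, Real.sign_of_neg (mul_neg_of_pos_of_neg hs ht)]
      norm_num
    · simp [ht]
    · rw [Real.sign_of_pos hs, Real.sign_of_pos ht, Real.sign_of_pos (mul_pos hs ht)]
      norm_num
  rw [this]; ring

lemma phi_strictMono {q : ℝ} (hq : 1 < q) : StrictMono (phi q) := by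
  have hpos : ∀ s, 0 < s → 0 < phi q s := fun s hs => by
    rw [phi_of_pos q hs]; exact Real.rpow_pos_of_pos hs _
  have hneg : ∀ s, s < 0 → phi q s < 0 := fun s hs => by
    have := hpos (-s) (by linarith)
    rw [phi_neg] at this; linarith
  have hpp : ∀ s t, 0 < s → s < t → phi q s < phi q t := fun s t hs hst => by
    rw [phi_of_pos q hs, phi_of_pos q (hs.trans hst)]
    exact Real.rpow_lt_rpow hs.le hst (by linarith)
  intro s t hst
  rcases lt_trichotomy s 0 with hs | hs | hs
  · rcases lt_trichotomy t 0 with ht | ht | ht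
    · have := hpp (-t) (-s) (by linarith) (by linarith)
      rw [phi_neg, phi_neg] at this; linarith
    · rw [ht, phi_zero]; exact hneg s hs
    · exact (hneg s hs).trans (hpos t ht)
  · rw [hs, phi_zero]; exact hpos t (hs ▸ hst)
  · exact hpp s t hs hst

lemma phi_eq_zero {q : ℝ} (hq : 1 < q) {s : ℝ} (h : phi q s = 0) : s = 0 :=
  (phi_strictMono hq).injective (h.trans (phi_zero q).symm)

lemma phi_continuous {q : ℝ} (hq : 1 < q) : Continuous (phi q) := by
  have h1 : Continuous fun s : ℝ => (max s 0) ^ (q - 1) - (max (-s) 0) ^ (q - 1) := by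
    refine Continuous.sub ?_ ?_
    · exact Continuous.rpow_const (by fun_prop) fun _ => Or.inr (by linarith)
    · exact Continuous.rpow_const (by fun_prop) fun _ => Or.inr (by linarith)
  convert h1 using 1
  funext s
  have h0 : (0 : ℝ) ^ (q - 1) = 0 := Real.zero_rpow (by linarith)
  rcases lt_trichotomy s 0 with hs | hs | hs
  · rw [phi, Real.sign_of_neg hs, abs_of_neg hs, max_eq_right hs.le, max_eq_left (by linarith), h0]
    ring
  · simp [hs, phi_zero]
  · rw [phi_of_pos q hs, max_eq_left hs.le, max_eq_right (by linarith), h0]; ring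

lemma phi_det {q : ℝ} (hq : 1 < q) {a b c d : ℝ} (h : a * d - b * c ≠ 0) :
    phi q a * phi q d - phi q b * phi q c ≠ 0 := by
  rw [← phi_mul, ← phi_mul]
  intro h'
  exact h (sub_eq_zero.2 ((phi_strictMono hq).injective (sub_eq_zero.1 h')))

/-- Normals of the placement `x`. -/
def Nq (q : ℝ) (x : V → Fin 2 → ℝ) (v w : V) (i : Fin 2) : ℝ := rigidityCoef q (x v i) (x w i)

/-- Value of the edge constraint on `u`. -/
def sig (N : V → V → Fin 2 → ℝ) (u : V → Fin 2 → ℝ) (v w : V) : ℝ :=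
  N v w 0 * (u v 0 - u w 0) + N v w 1 * (u v 1 - u w 1)

def Anti (N : V → V → Fin 2 → ℝ) : Prop := ∀ v w i, N w v i = - N v w i

/-- Surjectivity of the rigidity operator. -/
def IndepN (F : SimpleGraph V) (N : V → V → Fin 2 → ℝ) : Prop :=
  ∀ ω : V → V → ℝ, (∀ v w, F.Adj v w → ω v w = ω w v) →
    ∃ u : V → Fin 2 → ℝ, ∀ v w, F.Adj v w → sig N u v w = ω v w

lemma anti_Nq (q : ℝ) (x : V → Fin 2 → ℝ) : Anti (Nq q x) := by
  intro v w i
  rw [Nq, Nq, rigidityCoef_eq, rigidityCoef_eq, ← phi_neg, neg_sub]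

lemma sig_symm {N : V → V → Fin 2 → ℝ} (hN : Anti N) (u : V → Fin 2 → ℝ) (v w : V) :
    sig N u v w = sig N u w v := by
  simp only [sig, hN v w]; ring

def rowN (N : V → V → Fin 2 → ℝ) (v w : V) : V × Fin 2 → ℝ :=
  fun z => (if z.1 = v then N v w z.2 else 0) - (if z.1 = w then N v w z.2 else 0)

lemma rowN_symm {N : V → V → Fin 2 → ℝ} (hN : Anti N) (v w : V) : rowN N w v = rowN N v w := by
  funext z
  simp only [rowN, hN v w]
  split_ifs <;> ring

/-- Chosen orientation of an edge. -/
def ee (F : SimpleGraph V) (e : F.edgeSet) : V × V := Quot.out e.1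

lemma ee_mk (F : SimpleGraph V) (e : F.edgeSet) : s((ee F e).1, (ee F e).2) = e.1 :=
  Quot.out_eq e.1

lemma ee_adj (F : SimpleGraph V) (e : F.edgeSet) : F.Adj (ee F e).1 (ee F e).2 := by
  rw [← SimpleGraph.mem_edgeSet, ee_mk]; exact e.2

lemma ee_cases (F : SimpleGraph V) {v w : V} (h : F.Adj v w) :
    ∃ e : F.edgeSet, ((ee F e).1 = v ∧ (ee F e).2 = w) ∨ ((ee F e).1 = w ∧ (ee F e).2 = v) := by
  refine ⟨⟨s(v, w), h⟩, ?_⟩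
  have := ee_mk F ⟨s(v, w), h⟩
  simpa only [Sym2.eq_iff] using this

def rows (F : SimpleGraph V) (N : V → V → Fin 2 → ℝ) (e : F.edgeSet) : V × Fin 2 → ℝ :=
  rowN N (ee F e).1 (ee F e).2

lemma span_rows (F : SimpleGraph V) {N : V → V → Fin 2 → ℝ} (hN : Anti N) :
    Submodule.span ℝ {r : V × Fin 2 → ℝ | ∃ v w, F.Adj v w ∧ r = rowN N v w} =
      Submodule.span ℝ (Set.range (rows F N)) := by
  apply le_antisymm
  · rw [Submodule.span_le]
    rintro r ⟨v, w, h, rfl⟩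
    obtain ⟨e, ⟨h1, h2⟩ | ⟨h1, h2⟩⟩ := ee_cases F h
    · exact Submodule.subset_span ⟨e, by rw [rows, h1, h2]⟩
    · rw [rowN_symm hN]
      exact Submodule.subset_span ⟨e, by rw [rows, h1, h2]⟩
  · apply Submodule.span_mono
    rintro r ⟨e, rfl⟩
    exact ⟨_, _, ee_adj F e, rfl⟩

lemma sum_rowN [Fintype V] (N : V → V → Fin 2 → ℝ) (u : V → Fin 2 → ℝ) (v w : V) :
    ∑ z : V × Fin 2, rowN N v w z * u z.1 z.2 = sig N u v w := by
  simp only [rowN, sig, Fintype.sum_prod_type, Fin.sum_univ_two, sub_mul, ite_mul, zero_mul,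
    Finset.sum_add_distrib, Finset.sum_sub_distrib, Finset.sum_ite_eq', Finset.mem_univ, if_true]
  ring

lemma indepN_iff_LI [Fintype V] (F : SimpleGraph V) {N : V → V → Fin 2 → ℝ} (hN : Anti N) :
    IndepN F N ↔ LinearIndependent ℝ (rows F N) := by
  constructor
  · intro h
    rw [Fintype.linearIndependent_iff]
    intro g hg
    let ω : V → V → ℝ := fun v w => if h : F.Adj v w then g ⟨s(v, w), h⟩ else 0
    have hω : ∀ v w, F.Adj v w → ω v w = ω w v := by
      intro v w hvw
      simp only [ω, dif_pos hvw, dif_pos hvw.symm]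
      congr 2
      exact Sym2.eq_swap
    obtain ⟨u, hu⟩ := h ω hω
    have h1 : ∀ e, ∑ z : V × Fin 2, rows F N e z * u z.1 z.2 = g e := by
      intro e
      rw [rows, sum_rowN, hu _ _ (ee_adj F e)]
      simp only [ω, dif_pos (ee_adj F e)]
      congr 1
      exact Subtype.ext (ee_mk F e)
    have h2 : ∑ e, g e * g e = 0 := by
      calc ∑ e, g e * g e = ∑ e, g e * ∑ z : V × Fin 2, rows F N e z * u z.1 z.2 := by
            simp_rw [h1]
        _ = ∑ z : V × Fin 2, (∑ e, g e • rows F N e) z * u z.1 z.2 := by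
            simp_rw [Finset.mul_sum]
            rw [Finset.sum_comm]
            refine Finset.sum_congr rfl fun z _ => ?_
            rw [Finset.sum_apply, Finset.sum_mul]
            refine Finset.sum_congr rfl fun e _ => ?_
            simp [mul_assoc]
        _ = 0 := by rw [hg]; simp
    intro e
    have := (Finset.sum_eq_zero_iff_of_nonneg (fun e _ => mul_self_nonneg (g e))).1 h2 e
      (Finset.mem_univ _)
    exact mul_self_eq_zero.1 this
  · intro h ω hω
    let M : Matrix F.edgeSet (V × Fin 2) ℝ := Matrix.of (rows F N)
    have hr : M.rank = Fintype.card F.edgeSet := LinearIndependent.rank_matrix (M := M) h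
    have hs : LinearMap.range M.mulVecLin = ⊤ := by
      apply Submodule.eq_top_of_finrank_eq
      rw [← Matrix.rank, hr]; simp
    obtain ⟨U, hU⟩ := LinearMap.range_eq_top.1 hs fun e => ω (ee F e).1 (ee F e).2
    refine ⟨fun v i => U (v, i), ?_⟩
    have key : ∀ e, sig N (fun v i => U (v, i)) (ee F e).1 (ee F e).2
        = ω (ee F e).1 (ee F e).2 := by
      intro e
      rw [← sum_rowN, ← congrFun hU e]
      rfl
    intro v w hvw
    obtain ⟨e, ⟨h1, h2⟩ | ⟨h1, h2⟩⟩ := ee_cases F hvw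
    · have := key e
      rwa [h1, h2] at this
    · have := key e
      rw [h1, h2] at this
      rw [sig_symm hN, this, hω _ _ hvw]

lemma indepN_eventually [Fintype V] (F : SimpleGraph V) (N : ℝ → V → V → Fin 2 → ℝ)
    (hN : ∀ t, Anti (N t)) (hc : ∀ v w i, ContinuousAt (fun t => N t v w i) 0)
    (h : IndepN F (N 0)) : ∀ᶠ t in 𝓝 (0 : ℝ), IndepN F (N t) := by
  rw [indepN_iff_LI F (hN 0)] at h
  have hcont : ContinuousAt (fun t => rows F (N t)) 0 := by
    refine continuousAt_pi.2 fun e => continuousAt_pi.2 fun z => ?_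
    simp only [rows, rowN]
    refine ContinuousAt.sub ?_ ?_
    · split_ifs
      · exact hc _ _ _
      · exact continuousAt_const
    · split_ifs
      · exact hc _ _ _
      · exact continuousAt_const
  have := hcont.eventually (LinearIndependent.eventually h)
  filter_upwards [this] with t ht
  exact (indepN_iff_LI F (hN t)).2 ht

lemma rank_eq [Fintype V] (q : ℝ) (F : SimpleGraph V) (x : V → Fin 2 → ℝ) :
    rigidityRank q F x = (Set.range (rows F (Nq q x))).finrank ℝ := by
  have := span_rows F (anti_Nq q x)
  unfold rigidityRank Set.finrank
  rw [← this]
  rfl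

lemma indepN_iff_rank [Fintype V] (q : ℝ) (F : SimpleGraph V) (x : V → Fin 2 → ℝ) :
    IndepN F (Nq q x) ↔ Fintype.card F.edgeSet ≤ rigidityRank q F x := by
  rw [indepN_iff_LI F (anti_Nq q x), linearIndependent_iff_card_le_finrank_span, rank_eq]

lemma indepN_placement {q : ℝ} {F : SimpleGraph V} {x : V → Fin 2 → ℝ} (h : IndepN F (Nq q x)) :
    IsPlacement F x := by
  intro v w hvw he
  obtain ⟨u, hu⟩ := h (fun _ _ => 1) (fun _ _ _ => rfl)
  have := hu v w hvw
  simp [sig, Nq, rigidityCoef_eq, he, phi_zero] at this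

lemma indepN_of_regular [Fintype V] {q : ℝ} {F : SimpleGraph V} {x p : V → Fin 2 → ℝ}
    (h : IndepN F (Nq q x)) (hp : IsRegular q F p) : IndepN F (Nq q p) := by
  have h1 := indepN_placement h
  rw [indepN_iff_rank] at h ⊢
  exact h.trans (hp.2 x h1)


/-! ### Extension constructions -/

def GP (x : V → Fin 2 → ℝ) : Prop :=
  (∀ a b, a ≠ b → x a 0 ≠ x b 0) ∧ ∀ a b c, a ≠ b → a ≠ c → b ≠ c →
    (x b 0 - x a 0) * (x c 1 - x a 1) - (x b 1 - x a 1) * (x c 0 - x a 0) ≠ 0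

lemma quad_ev (A B C : ℝ) (h : B ≠ 0 ∨ C ≠ 0) : ∀ᶠ t in 𝓝[≠] (0 : ℝ), A + B * t + C * t ^ 2 ≠ 0 := by
  let P : Polynomial ℝ := Polynomial.C A + Polynomial.C B * Polynomial.X
    + Polynomial.C C * Polynomial.X ^ 2
  have hP : P ≠ 0 := by
    intro h0
    have h1 : P.coeff 1 = B := by simp [P, Polynomial.coeff_X, Polynomial.coeff_C]
    have h2 : P.coeff 2 = C := by simp [P, Polynomial.coeff_X, Polynomial.coeff_C]
    rw [h0] at h1 h2
    simp at h1 h2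
    rcases h with h | h
    · exact h h1.symm
    · exact h h2.symm
  have hfin : ({t | P.IsRoot t} : Set ℝ).Finite := Polynomial.finite_setOf_isRoot hP
  have hcl : IsClosed (({t | P.IsRoot t} : Set ℝ) \ {0}) := (hfin.subset diff_subset).isClosed
  have hmem : (({t | P.IsRoot t} : Set ℝ) \ {0})ᶜ ∈ 𝓝 (0 : ℝ) :=
    hcl.isOpen_compl.mem_nhds (by simp)
  filter_upwards [mem_nhdsWithin_of_mem_nhds hmem, self_mem_nhdsWithin] with t ht ht0 h
  apply ht
  refine ⟨?_, ht0⟩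
  change P.eval t = 0
  simpa [P] using h

lemma exists_GP [Fintype V] {q : ℝ} (hq : 1 < q) {F : SimpleGraph V} {x : V → Fin 2 → ℝ}
    (h : IndepN F (Nq q x)) : ∃ x', GP x' ∧ IndepN F (Nq q x') := by
  obtain ⟨k, hk⟩ : ∃ k : V → ℝ, Function.Injective k :=
    ⟨fun v => ((Fintype.equivFin V v : ℕ) : ℝ), fun a b hab =>
      (Fintype.equivFin V).injective (Fin.ext (by
        have h : ((Fintype.equivFin V a : ℕ) : ℝ) = ((Fintype.equivFin V b : ℕ) : ℝ) := hab
        exact_mod_cast h))⟩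
  let X : ℝ → V → Fin 2 → ℝ := fun t v => ![x v 0 + t * k v, x v 1 + t * k v ^ 2]
  have hX0 : X 0 = x := by
    funext v i
    fin_cases i <;> simp [X]
  have hev : ∀ᶠ t in 𝓝 (0 : ℝ), IndepN F (Nq q (X t)) := by
    apply indepN_eventually F (fun t => Nq q (X t)) (fun t => anti_Nq q _)
    · intro v w i
      refine (Continuous.continuousAt ?_)
      simp only [Nq, rigidityCoef_eq]
      refine (phi_continuous hq).comp ?_
      fin_cases i
      · simp only [X, Fin.zero_eta, Matrix.cons_val_zero]; fun_prop
      · simp only [X, Fin.mk_one, Matrix.cons_val_one]; fun_prop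
    · simpa only [hX0] using h
  have h1 : ∀ᶠ t in 𝓝[≠] (0 : ℝ), ∀ a b, a ≠ b → X t a 0 ≠ X t b 0 := by
    refine eventually_all.2 fun a => eventually_all.2 fun b => ?_
    by_cases hab : a = b
    · exact Eventually.of_forall fun t h => absurd hab h
    · filter_upwards [quad_ev (x a 0 - x b 0) (k a - k b) 0
        (Or.inl (sub_ne_zero.2 fun h => hab (hk h)))] with t ht _ h
      apply ht
      simp only [X, Matrix.cons_val_zero] at h
      linarith
  have h2 : ∀ᶠ t in 𝓝[≠] (0 : ℝ), ∀ a b c, a ≠ b → a ≠ c → b ≠ c →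
    (X t b 0 - X t a 0) * (X t c 1 - X t a 1) - (X t b 1 - X t a 1) * (X t c 0 - X t a 0) ≠ 0 := by
    refine eventually_all.2 fun a => eventually_all.2 fun b => eventually_all.2 fun c => ?_
    by_cases hab : a = b
    · exact Eventually.of_forall fun t h => absurd hab h
    by_cases hac : a = c
    · exact Eventually.of_forall fun t _ h => absurd hac h
    by_cases hbc : b = c
    · exact Eventually.of_forall fun t _ _ h => absurd hbc h
    have hC : (k b - k a) * (k c ^ 2 - k a ^ 2) - (k b ^ 2 - k a ^ 2) * (k c - k a) ≠ 0 := by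
      have : (k b - k a) * (k c ^ 2 - k a ^ 2) - (k b ^ 2 - k a ^ 2) * (k c - k a)
        = (k b - k a) * (k c - k a) * (k c - k b) := by ring
      rw [this]
      refine mul_ne_zero (mul_ne_zero ?_ ?_) ?_ <;> rw [sub_ne_zero]
      · exact fun h => hab (hk h).symm
      · exact fun h => hac (hk h).symm
      · exact fun h => hbc (hk h).symm
    filter_upwards [quad_ev
        ((x b 0 - x a 0) * (x c 1 - x a 1) - (x b 1 - x a 1) * (x c 0 - x a 0))
        ((x b 0 - x a 0) * (k c ^ 2 - k a ^ 2) + (k b - k a) * (x c 1 - x a 1)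
          - (x b 1 - x a 1) * (k c - k a) - (k b ^ 2 - k a ^ 2) * (x c 0 - x a 0))
        _ (Or.inr hC)] with t ht _ _ _ h
    apply ht
    simp only [X, Matrix.cons_val_zero, Matrix.cons_val_one] at h
    rw [← h]; ring
  obtain ⟨t, ⟨ht1, ht2⟩, ht3⟩ :=
    ((h1.and h2).and (hev.filter_mono nhdsWithin_le_nhds)).exists
  exact ⟨X t, ⟨ht1, ht2⟩, ht3⟩

lemma solve2 {a b c d : ℝ} (h : a * d - b * c ≠ 0) (α β : ℝ) :
    ∃ s : Fin 2 → ℝ, a * s 0 + b * s 1 = α ∧ c * s 0 + d * s 1 = β := by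
  refine ⟨![(α * d - b * β) / (a * d - b * c), (a * β - α * c) / (a * d - b * c)], ?_, ?_⟩
  · simp only [Matrix.cons_val_zero, Matrix.cons_val_one]
    rw [mul_div_assoc', mul_div_assoc', ← add_div, div_eq_iff h]; ring
  · simp only [Matrix.cons_val_zero, Matrix.cons_val_one]
    rw [mul_div_assoc', mul_div_assoc', ← add_div, div_eq_iff h]; ring

/-- Delete all edges at `v`. -/
def del (F : SimpleGraph V) (v : V) : SimpleGraph V where
  Adj a b := F.Adj a b ∧ a ≠ v ∧ b ≠ v
  symm := ⟨fun _ _ h => ⟨h.1.symm, h.2.2, h.2.1⟩⟩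
  loopless := ⟨fun a h => F.loopless.irrefl a h.1⟩

/-- Keep only the edges inside `T`. -/
def res (F : SimpleGraph V) (T : Finset V) : SimpleGraph V where
  Adj a b := F.Adj a b ∧ a ∈ T ∧ b ∈ T
  symm := ⟨fun _ _ h => ⟨h.1.symm, h.2.2, h.2.1⟩⟩
  loopless := ⟨fun a h => F.loopless.irrefl a h.1⟩

lemma extend {F : SimpleGraph V} {v : V} {N : V → V → Fin 2 → ℝ} (hN : Anti N)
    {ω : V → V → ℝ} (hω : ∀ v w, F.Adj v w → ω v w = ω w v) {u : V → Fin 2 → ℝ}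
    (hu : ∀ a b, (del F v).Adj a b → sig N u a b = ω a b) (s : Fin 2 → ℝ)
    (hs : ∀ w, F.Adj v w → N v w 0 * (s 0 - u w 0) + N v w 1 * (s 1 - u w 1) = ω v w) :
    ∃ u : V → Fin 2 → ℝ, ∀ a b, F.Adj a b → sig N u a b = ω a b := by
  refine ⟨Function.update u v s, ?_⟩
  have key : ∀ w, F.Adj v w → sig N (Function.update u v s) v w = ω v w := by
    intro w hw
    rw [← hs w hw, sig, Function.update_self, Function.update_of_ne hw.ne']
  intro a b hab
  by_cases ha : a = v
  · subst ha; exact key b hab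
  by_cases hb : b = v
  · subst hb; rw [sig_symm hN, hω _ _ hab]; exact key a hab.symm
  rw [← hu a b ⟨hab, ha, hb⟩, sig, sig, Function.update_of_ne ha, Function.update_of_ne hb]

/-- `F` has a placement with independent rows. -/
def Ind (q : ℝ) (F : SimpleGraph V) : Prop := ∃ x : V → Fin 2 → ℝ, IndepN F (Nq q x)

lemma ext_one [Fintype V] {q : ℝ} (hq : 1 < q) {F : SimpleGraph V} {v a : V} (hva : v ≠ a)
    (hn : ∀ w, F.Adj v w → w = a) (h : Ind q (del F v)) : Ind q F := by
  obtain ⟨x0, hx0⟩ := h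
  obtain ⟨x, hx, hi⟩ := exists_GP hq hx0
  refine ⟨x, fun ω hω => ?_⟩
  obtain ⟨u, hu⟩ := hi ω fun a b hab => hω a b hab.1
  have h0 : Nq q x v a 0 ≠ 0 := fun h => hx.1 v a hva (sub_eq_zero.1 (phi_eq_zero hq h))
  have hd : Nq q x v a 0 * Nq q x v a 0 - Nq q x v a 1 * (- Nq q x v a 1) ≠ 0 := by
    have := mul_self_pos.2 h0
    have := mul_self_nonneg (Nq q x v a 1)
    intro h
    linarith
  obtain ⟨s, hs, -⟩ := solve2 hd (ω v a + Nq q x v a 0 * u a 0 + Nq q x v a 1 * u a 1) 0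
  refine extend (anti_Nq q x) hω hu s fun w hw => ?_
  rw [hn w hw]
  linarith

lemma ext_two [Fintype V] {q : ℝ} (hq : 1 < q) {F : SimpleGraph V} {v a b : V} (hva : v ≠ a)
    (hvb : v ≠ b) (hab : a ≠ b)
    (hn : ∀ w, F.Adj v w → w = a ∨ w = b) (h : Ind q (del F v)) : Ind q F := by
  obtain ⟨x0, hx0⟩ := h
  obtain ⟨x, hx, hi⟩ := exists_GP hq hx0
  refine ⟨x, fun ω hω => ?_⟩
  obtain ⟨u, hu⟩ := hi ω fun a b hab => hω a b hab.1
  have hd : Nq q x v a 0 * Nq q x v b 1 - Nq q x v a 1 * Nq q x v b 0 ≠ 0 := by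
    apply phi_det hq
    have := hx.2 v a b hva hvb hab
    intro h
    apply this
    rw [← h]; ring
  obtain ⟨s, hs, hs'⟩ := solve2 hd (ω v a + Nq q x v a 0 * u a 0 + Nq q x v a 1 * u a 1)
    (ω v b + Nq q x v b 0 * u b 0 + Nq q x v b 1 * u b 1)
  refine extend (anti_Nq q x) hω hu s fun w hw => ?_
  rcases hn w hw with rfl | rfl
  · linarith
  · linarith

lemma ext_three [Fintype V] {q : ℝ} (hq : 1 < q) {F : SimpleGraph V} {v a b c : V} (hva : v ≠ a)
    (hvb : v ≠ b) (hvc : v ≠ c) (hab : a ≠ b) (hac : a ≠ c) (hbc : b ≠ c)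
    (hnab : ¬ F.Adj a b)
    (hn : ∀ w, F.Adj v w → w = a ∨ w = b ∨ w = c)
    (h : Ind q (del F v ⊔ SimpleGraph.edge a b)) : Ind q F := by
  obtain ⟨x0, hx0⟩ := h
  obtain ⟨x, hx, hi⟩ := exists_GP hq hx0
  let x' : V → Fin 2 → ℝ := Function.update x v (fun i => (x a i + x b i) / 2)
  have hx'v : x' v = fun i => (x a i + x b i) / 2 := Function.update_self ..
  have hx'n : ∀ w, w ≠ v → x' w = x w := fun w hw => Function.update_of_ne hw ..
  refine ⟨x', fun ω hω => ?_⟩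
  set k : ℝ := phi q (1 / 2) with hk
  have hk0 : k ≠ 0 := fun h => by
    have := phi_eq_zero hq h
    norm_num at this
  have hNa : ∀ i, Nq q x' v a i = k * phi q (x b i - x a i) := by
    intro i
    rw [Nq, rigidityCoef_eq, hx'v, hx'n a hva.symm, hk, ← phi_mul]
    congr 1; ring
  have hNb : ∀ i, Nq q x' v b i = - (k * phi q (x b i - x a i)) := by
    intro i
    rw [Nq, rigidityCoef_eq, hx'v, hx'n b hvb.symm, hk, ← phi_mul, ← phi_neg]
    congr 1; ring
  have hd : phi q (x b 0 - x a 0) * Nq q x' v c 1 - phi q (x b 1 - x a 1) * Nq q x' v c 0 ≠ 0 := by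
    simp only [Nq, rigidityCoef_eq, hx'v, hx'n c hvc.symm]
    apply phi_det hq
    have := hx.2 a b c hab hac hbc
    intro h
    apply this
    linear_combination -h
  let ω' : V → V → ℝ := fun p r => if (p = a ∧ r = b) ∨ (p = b ∧ r = a) then
    (ω v a + ω v b) / k else ω p r
  obtain ⟨u, hu⟩ := hi ω' (by
    intro p r hpr
    simp only [ω']
    by_cases h1 : (p = a ∧ r = b) ∨ (p = b ∧ r = a)
    · rw [if_pos h1, if_pos (by tauto)]
    · rw [if_neg h1, if_neg (by tauto)]
      rcases hpr with hpr | hpr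
      · exact hω _ _ hpr.1
      · rw [SimpleGraph.edge_adj] at hpr; tauto)
  have hba := hu b a (Or.inr (by rw [SimpleGraph.edge_adj]; exact ⟨Or.inr ⟨rfl, rfl⟩, hab.symm⟩))
  simp only [ω', if_pos (show (b = a ∧ a = b) ∨ (b = b ∧ a = a) from Or.inr ⟨rfl, rfl⟩), sig, Nq,
    rigidityCoef_eq] at hba
  rw [eq_div_iff hk0] at hba
  obtain ⟨s, hs, hs'⟩ := solve2 hd
    (ω v a / k + phi q (x b 0 - x a 0) * u a 0 + phi q (x b 1 - x a 1) * u a 1)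
    (ω v c + Nq q x' v c 0 * u c 0 + Nq q x' v c 1 * u c 1)
  have hs2 : k * (phi q (x b 0 - x a 0) * s 0 + phi q (x b 1 - x a 1) * s 1) =
    ω v a + k * (phi q (x b 0 - x a 0) * u a 0 + phi q (x b 1 - x a 1) * u a 1) := by
    rw [hs, add_assoc, mul_add, mul_div_cancel₀ _ hk0]
  refine extend (v := v) (u := u) (anti_Nq q x') hω (fun p r hpr => ?_) s fun w hw => ?_
  · have h1 := hu p r (Or.inl hpr)
    have h2 : ¬ ((p = a ∧ r = b) ∨ (p = b ∧ r = a)) := by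
      rintro (⟨rfl, rfl⟩ | ⟨rfl, rfl⟩)
      · exact hnab hpr.1
      · exact hnab hpr.1.symm
    simp only [ω', if_neg h2] at h1
    rw [← h1]
    simp only [sig, Nq, hx'n p hpr.2.1, hx'n r hpr.2.2]
  · rcases hn w hw with rfl | rfl | rfl
    · rw [hNa, hNa]; linear_combination hs2
    · rw [hNb, hNb]; linear_combination hba - hs2
    · linarith

lemma ind_K4 {q : ℝ} (hq : 1 < q) (hq2 : q ≠ 2) {F : SimpleGraph V} {v a b c : V} (hva : v ≠ a)
    (hvb : v ≠ b) (hvc : v ≠ c) (hab : a ≠ b) (hac : a ≠ c) (hbc : b ≠ c)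
    (hF : ∀ s t, F.Adj s t → (s = v ∨ s = a ∨ s = b ∨ s = c)) : Ind q F := by
  set h : ℝ := phi q (1 / 2) with hh
  have hh0 : h ≠ 0 := fun h => by
    have := phi_eq_zero hq h
    norm_num at this
  have hh2 : 1 - 2 * h ≠ 0 := by
    intro h0
    have h1 : h = (1 / 2 : ℝ) ^ (1 : ℝ) := by rw [Real.rpow_one]; linarith
    rw [hh, phi_of_pos q (by norm_num)] at h1
    have := (Real.rpow_right_inj (x := (1 / 2 : ℝ)) (by norm_num) (by norm_num)).1 h1
    apply hq2; linarith
  let x : V → Fin 2 → ℝ := fun w => if w = v then ![0, 0] else if w = a then ![1, 0] else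
    if w = b then ![0, 1] else ![1, 1 / 2]
  have xv : x v = ![0, 0] := by simp [x]
  have xa : x a = ![1, 0] := by simp [x, hva.symm]
  have xb : x b = ![0, 1] := by simp [x, hvb.symm, hab.symm]
  have xc : x c = ![1, 1 / 2] := by simp [x, hvc.symm, hac.symm, hbc.symm]
  refine ⟨x, fun ω hω => ?_⟩
  let s : ℝ := (ω b c - (ω v c - 2 * ω a c - ω v a - ω v b + ω a b + h * ω v b)) / (1 - 2 * h)
  have hs : s * (1 - 2 * h) = ω b c - (ω v c - 2 * ω a c - ω v a - ω v b + ω a b + h * ω v b) :=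
    div_mul_cancel₀ _ hh2
  let c1 : ℝ := s + ω a c / h
  have hc1 : h * c1 = h * s + ω a c := by simp only [c1]; rw [mul_add, mul_div_cancel₀ _ hh0]
  let u : V → Fin 2 → ℝ := fun w => if w = v then ![0, 0] else if w = a then ![ω v a, s] else
    if w = b then ![ω v a - s + ω v b - ω a b, ω v b] else ![ω v c - h * c1, c1]
  have uv : u v = ![0, 0] := by simp [u]
  have ua : u a = ![ω v a, s] := by simp [u, hva.symm]
  have ub : u b = ![ω v a - s + ω v b - ω a b, ω v b] := by simp [u, hvb.symm, hab.symm]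
  have uc : u c = ![ω v c - h * c1, c1] := by simp [u, hvc.symm, hac.symm, hbc.symm]
  have pm1 : phi q (-1) = -1 := by rw [phi_neg, phi_one]
  have pmh : phi q (-(1 / 2)) = -h := by rw [phi_neg]
  have e1 : sig (Nq q x) u v a = ω v a := by
    simp [sig, Nq, rigidityCoef_eq, xv, xa, uv, ua, pm1, phi_zero]
  have e2 : sig (Nq q x) u v b = ω v b := by
    simp [sig, Nq, rigidityCoef_eq, xv, xb, uv, ub, pm1, phi_zero]
  have e3 : sig (Nq q x) u v c = ω v c := by
    simp only [sig, Nq, rigidityCoef_eq, xv, xc, uv, uc, Matrix.cons_val_zero, Matrix.cons_val_one,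
      zero_sub, pm1, pmh]
    ring
  have e4 : sig (Nq q x) u a b = ω a b := by
    simp only [sig, Nq, rigidityCoef_eq, xa, xb, ua, ub, Matrix.cons_val_zero, Matrix.cons_val_one,
      zero_sub, sub_zero, pm1, phi_one]
    ring
  have e5 : sig (Nq q x) u a c = ω a c := by
    simp only [sig, Nq, rigidityCoef_eq, xa, xc, ua, uc, Matrix.cons_val_zero, Matrix.cons_val_one,
      zero_sub, sub_self, pmh, phi_zero]
    linear_combination hc1
  have e6 : sig (Nq q x) u b c = ω b c := by
    simp only [sig, Nq, rigidityCoef_eq, xb, xc, ub, uc, Matrix.cons_val_zero, Matrix.cons_val_one,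
      zero_sub, pm1, show (1 : ℝ) - 1 / 2 = 1 / 2 by norm_num]
    rw [← hh]
    linear_combination hs - 2 * hc1
  refine ⟨u, fun p r hpr => ?_⟩
  have hsw : sig (Nq q x) u r p = ω r p → sig (Nq q x) u p r = ω p r := fun h => by
    rw [sig_symm (anti_Nq q x), h, hω _ _ hpr]
  have hne := hpr.ne
  rcases hF p r hpr with rfl | rfl | rfl | rfl <;> rcases hF r _ hpr.symm with rfl | rfl | rfl | rfl
  all_goals first
    | exact absurd rfl hne
    | assumption
    | (apply hsw; assumption)

/-- Contraction of `T` to `t0`. -/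
def ctr (F : SimpleGraph V) (T : Finset V) (t0 : V) : SimpleGraph V where
  Adj a b := a ≠ b ∧ ∃ v w, F.Adj v w ∧ (if v ∈ T then t0 else v) = a ∧ (if w ∈ T then t0 else w) = b
  symm := ⟨fun _ _ ⟨h, v, w, h1, h2, h3⟩ => ⟨h.symm, w, v, h1.symm, h3, h2⟩⟩
  loopless := ⟨fun _ h => h.1 rfl⟩

lemma ind_ctr [Fintype V] {q : ℝ} (hq : 1 < q) {F : SimpleGraph V} {T : Finset V} {t0 : V}
    (ht0 : t0 ∈ T)
    (huniq : ∀ o t t', o ∉ T → t ∈ T → t' ∈ T → F.Adj o t → F.Adj o t' → t = t')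
    (h1 : Ind q (res F T)) (h2 : Ind q (ctr F T t0)) : Ind q F := by
  obtain ⟨y, hy⟩ := h1
  obtain ⟨z, hz⟩ := h2
  set π : V → V := fun v => if v ∈ T then t0 else v with hπ
  have hπT : ∀ v, v ∈ T → π v = t0 := fun v hv => if_pos hv
  have hπn : ∀ v, v ∉ T → π v = v := fun v hv => if_neg hv
  let X : ℝ → V → Fin 2 → ℝ := fun t v i => z (π v) i + (if v ∈ T then t * y v i else 0)
  let N : ℝ → V → V → Fin 2 → ℝ := fun t v w =>
    if v ∈ T ∧ w ∈ T then Nq q y v w else Nq q (X t) v w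
  have hNanti : ∀ t, Anti (N t) := by
    intro t v w i
    simp only [N]
    by_cases h : v ∈ T ∧ w ∈ T
    · rw [if_pos h, if_pos h.symm]; exact anti_Nq q y v w i
    · rw [if_neg h, if_neg (fun h' => h h'.symm)]; exact anti_Nq q _ v w i
  have hπne : ∀ v w, F.Adj v w → ¬ (v ∈ T ∧ w ∈ T) → π v ≠ π w := by
    intro v w hvw hT he
    by_cases hv : v ∈ T <;> by_cases hw : w ∈ T
    · exact hT ⟨hv, hw⟩
    · rw [hπT v hv, hπn w hw] at he; exact hw (he ▸ ht0)
    · rw [hπn v hv, hπT w hw] at he; exact hv (he ▸ ht0)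
    · rw [hπn v hv, hπn w hw] at he; exact hvw.ne he
  have hinj : ∀ v w v' w', F.Adj v w → F.Adj v' w' → π v ≠ π w → π v = π v' → π w = π w' →
      v = v' ∧ w = w' := by
    intro v w v' w' hvw hvw' hne hv hw
    have mem : ∀ a b, π a = π b → a ∈ T → b ∈ T := by
      intro a b hab ha
      by_contra hb
      rw [hπT a ha, hπn b hb] at hab
      exact hb (hab ▸ ht0)
    by_cases hvT : v ∈ T
    · have hv'T := mem _ _ hv hvT
      have hwT : w ∉ T := fun hwT => hne (by rw [hπT _ hvT, hπT _ hwT])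
      have hw'T : w' ∉ T := fun h => hwT (mem _ _ hw.symm h)
      rw [hπn _ hwT, hπn _ hw'T] at hw
      subst hw
      exact ⟨huniq w v v' hwT hvT hv'T hvw.symm hvw'.symm, rfl⟩
    · have hv'T : v' ∉ T := fun h => hvT (mem _ _ hv.symm h)
      rw [hπn _ hvT, hπn _ hv'T] at hv
      subst hv
      refine ⟨rfl, ?_⟩
      by_cases hwT : w ∈ T
      · exact huniq v w w' hvT hwT (mem _ _ hw hwT) hvw hvw'
      · have hw'T : w' ∉ T := fun h => hwT (mem _ _ hw.symm h)
        rwa [hπn _ hwT, hπn _ hw'T] at hw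
  have hX0 : ∀ v i, X 0 v i = z (π v) i := by
    intro v i; simp [X]
  have h0 : IndepN F (N 0) := by
    intro ω hω
    obtain ⟨s0, hs0⟩ := hy ω fun a b hab => hω a b hab.1
    let s : V → Fin 2 → ℝ := fun v => if v ∈ T then s0 v else 0
    let dd : V → V → ℝ := fun v w => ω v w -
      (Nq q z (π v) (π w) 0 * (s v 0 - s w 0) + Nq q z (π v) (π w) 1 * (s v 1 - s w 1))
    let ω' : V → V → ℝ := fun a b => if h : ∃ vw : V × V, F.Adj vw.1 vw.2 ∧ π vw.1 = a ∧ π vw.2 = b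
      then dd h.choose.1 h.choose.2 else 0
    have hω' : ∀ v w, F.Adj v w → π v ≠ π w → ω' (π v) (π w) = dd v w := by
      intro v w hvw hne
      have hex : ∃ vw : V × V, F.Adj vw.1 vw.2 ∧ π vw.1 = π v ∧ π vw.2 = π w :=
        ⟨(v, w), hvw, rfl, rfl⟩
      simp only [ω', dif_pos hex]
      have hc := hex.choose_spec
      obtain ⟨e1, e2⟩ := hinj v w _ _ hvw hc.1 hne hc.2.1.symm hc.2.2.symm
      rw [← e1, ← e2]
    have hdd : ∀ v w, F.Adj v w → dd v w = dd w v := by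
      intro v w hvw
      simp only [dd, hω v w hvw, anti_Nq q z (π v) (π w)]
      ring
    obtain ⟨u, hu⟩ := hz ω' (by
      rintro a b ⟨hne, v, w, hvw, rfl, rfl⟩
      have e1 := hω' v w hvw hne
      have e2 := hω' w v hvw.symm hne.symm
      exact e1.trans ((hdd v w hvw).trans e2.symm))
    refine ⟨fun v i => u (π v) i + s v i, fun v w hvw => ?_⟩
    by_cases hT : v ∈ T ∧ w ∈ T
    · have e := hs0 v w ⟨hvw, hT⟩
      simp only [sig, N, if_pos hT, hπT v hT.1, hπT w hT.2, s, if_pos hT.1, if_pos hT.2] at e ⊢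
      rw [← e]; ring
    · have hne := hπne v w hvw hT
      have e := hu (π v) (π w) ⟨hne, v, w, hvw, rfl, rfl⟩
      rw [hω' v w hvw hne] at e
      have hNN : ∀ i, N 0 v w i = Nq q z (π v) (π w) i := by
        intro i
        simp only [N, if_neg hT, Nq, hX0]
      simp only [sig, dd] at e
      simp only [sig, hNN]
      linear_combination e
  have hev := indepN_eventually F N hNanti (by
    intro v w i
    refine Continuous.continuousAt ?_
    by_cases hT : v ∈ T ∧ w ∈ T
    · simp only [N, if_pos hT]; exact continuous_const
    · simp only [N, if_neg hT, Nq, rigidityCoef_eq]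
      refine (phi_continuous hq).comp ?_
      simp only [X]
      refine Continuous.sub ?_ ?_ <;> refine continuous_const.add ?_ <;> split_ifs <;> fun_prop) h0
  obtain ⟨t, ht, htp⟩ := ((hev.filter_mono nhdsWithin_le_nhds).and
    (self_mem_nhdsWithin (s := Set.Ioi (0 : ℝ)))).exists
  have hk : phi q t ≠ 0 := fun h => (ne_of_gt htp) (phi_eq_zero hq h)
  refine ⟨X t, fun ω hω => ?_⟩
  obtain ⟨u, hu⟩ := ht (fun v w => if v ∈ T ∧ w ∈ T then ω v w / phi q t else ω v w) (by
    intro v w hvw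
    simp only [hω v w hvw, and_comm])
  refine ⟨u, fun v w hvw => ?_⟩
  have e := hu v w hvw
  by_cases hT : v ∈ T ∧ w ∈ T
  · simp only [sig, N, if_pos hT] at e
    rw [eq_div_iff hk] at e
    rw [← e]
    have hNN : ∀ i, Nq q (X t) v w i = phi q t * Nq q y v w i := by
      intro i
      simp only [Nq, rigidityCoef_eq, ← phi_mul, X, hπT v hT.1, hπT w hT.2, if_pos hT.1,
        if_pos hT.2]
      congr 1; ring
    simp only [sig, hNN]; ring
  · simpa only [sig, N, if_neg hT] using e



/-- Twice the number of edges of `F` inside `S`. -/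
def dd [Fintype V] (F : SimpleGraph V) (S : Finset V) : ℤ :=
  ∑ v, ∑ w, if F.Adj v w ∧ v ∈ S ∧ w ∈ S then 1 else 0

def dg [Fintype V] (F : SimpleGraph V) (v : V) (S : Finset V) : ℤ :=
  ∑ w, if F.Adj v w ∧ w ∈ S then 1 else 0

def Sparse [Fintype V] (l : ℤ) (F : SimpleGraph V) : Prop :=
  ∀ S : Finset V, 2 ≤ S.card → dd F S ≤ 4 * S.card - 2 * l

def Tight [Fintype V] (l : ℤ) (F : SimpleGraph V) (T : Finset V) : Prop :=
  2 ≤ T.card ∧ dd F T = 4 * T.card - 2 * l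

section comb
variable [Fintype V]

lemma dd_le {F F' : SimpleGraph V} {S S' : Finset V}
    (h : ∀ v w, F.Adj v w → v ∈ S → w ∈ S → F'.Adj v w ∧ v ∈ S' ∧ w ∈ S') :
    dd F S ≤ dd F' S' := by
  unfold dd
  refine Finset.sum_le_sum fun v _ => Finset.sum_le_sum fun w _ => ?_
  have := h v w
  split_ifs <;> first | omega | tauto

lemma dd_lt {F F' : SimpleGraph V} {S S' : Finset V}
    (h : ∀ v w, F.Adj v w → v ∈ S → w ∈ S → F'.Adj v w ∧ v ∈ S' ∧ w ∈ S') {a b : V}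
    (h1 : F'.Adj a b ∧ a ∈ S' ∧ b ∈ S') (h2 : ¬ (F.Adj a b ∧ a ∈ S ∧ b ∈ S)) :
    dd F S < dd F' S' := by
  unfold dd
  have hle : ∀ v w, (if F.Adj v w ∧ v ∈ S ∧ w ∈ S then (1 : ℤ) else 0) ≤
      if F'.Adj v w ∧ v ∈ S' ∧ w ∈ S' then 1 else 0 := by
    intro v w
    have := h v w
    split_ifs <;> first | omega | tauto
  refine Finset.sum_lt_sum (fun v _ => Finset.sum_le_sum fun w _ => hle v w)
    ⟨a, Finset.mem_univ _, Finset.sum_lt_sum (fun w _ => hle a w) ⟨b, Finset.mem_univ _, ?_⟩⟩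
  rw [if_neg h2, if_pos h1]; norm_num

lemma dd_nonneg (F : SimpleGraph V) (S : Finset V) : 0 ≤ dd F S :=
  Finset.sum_nonneg fun v _ => Finset.sum_nonneg fun w _ => by split_ifs <;> norm_num

lemma dg_nonneg (F : SimpleGraph V) (v : V) (S : Finset V) : 0 ≤ dg F v S :=
  Finset.sum_nonneg fun w _ => by split_ifs <;> norm_num

lemma dd_insert (F : SimpleGraph V) {v : V} {S : Finset V} (hv : v ∉ S) :
    dd F (insert v S) = dd F S + 2 * dg F v S := by
  have h : ∀ a b, (if F.Adj a b ∧ a ∈ insert v S ∧ b ∈ insert v S then (1 : ℤ) else 0) =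
      (if F.Adj a b ∧ a ∈ S ∧ b ∈ S then 1 else 0) +
      (if a = v then (if F.Adj v b ∧ b ∈ S then 1 else 0) else 0) +
      (if b = v then (if F.Adj v a ∧ a ∈ S then 1 else 0) else 0) := by
    intro a b
    have hvv := F.irrefl (v := v)
    have hs := F.adj_comm a v
    by_cases ha : a = v <;> by_cases hb : b = v <;> simp_all [Finset.mem_insert]
  unfold dd
  simp only [h, Finset.sum_add_distrib]
  have e1 : ∑ a, ∑ b, (if a = v then (if F.Adj v b ∧ b ∈ S then (1 : ℤ) else 0) else 0) = dg F v S := by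
    rw [Finset.sum_comm]
    unfold dg
    refine Finset.sum_congr rfl fun b _ => ?_
    rw [Finset.sum_ite_eq' Finset.univ v]; simp
  have e2 : ∑ a, ∑ b, (if b = v then (if F.Adj v a ∧ a ∈ S then (1 : ℤ) else 0) else 0) = dg F v S := by
    unfold dg
    refine Finset.sum_congr rfl fun b _ => ?_
    rw [Finset.sum_ite_eq' Finset.univ v]; simp
  rw [e1, e2]; ring

lemma dd_empty (F : SimpleGraph V) : dd F ∅ = 0 := by simp [dd]

lemma dd_small (F : SimpleGraph V) {S : Finset V} (h : S.card ≤ 1) : dd F S = 0 := by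
  unfold dd
  refine Finset.sum_eq_zero fun v _ => Finset.sum_eq_zero fun w _ => if_neg ?_
  rintro ⟨h1, h2, h3⟩
  exact h1.ne (Finset.card_le_one.1 h v h2 w h3)

lemma dd_even (F : SimpleGraph V) (S : Finset V) : ∃ k, dd F S = 2 * k := by
  induction S using Finset.induction_on with
  | empty => exact ⟨0, by rw [dd_empty]; rfl⟩
  | insert v S hv ih =>
    obtain ⟨k, hk⟩ := ih
    exact ⟨k + dg F v S, by rw [dd_insert F hv, hk]; ring⟩

lemma dd_super (F : SimpleGraph V) (A B : Finset V) :
    dd F A + dd F B ≤ dd F (A ∪ B) + dd F (A ∩ B) := by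
  unfold dd
  simp only [← Finset.sum_add_distrib]
  refine Finset.sum_le_sum fun v _ => Finset.sum_le_sum fun w _ => ?_
  simp only [Finset.mem_union, Finset.mem_inter]
  by_cases F.Adj v w <;> by_cases v ∈ A <;> by_cases w ∈ A <;> by_cases v ∈ B <;>
    by_cases w ∈ B <;> simp [*]

lemma dd_three (F : SimpleGraph V) {A B C : Finset V} (h1 : (A ∩ B).card ≤ 1)
    (h2 : (A ∩ C).card ≤ 1) (h3 : (B ∩ C).card ≤ 1) :
    dd F A + dd F B + dd F C ≤ dd F (A ∪ B ∪ C) := by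
  rw [Finset.card_le_one] at h1 h2 h3
  unfold dd
  simp only [← Finset.sum_add_distrib]
  refine Finset.sum_le_sum fun v _ => Finset.sum_le_sum fun w _ => ?_
  simp only [Finset.mem_union]
  by_cases hvw : F.Adj v w
  swap
  · simp [hvw]
  have hne := hvw.ne
  have h1 := fun h h' => hne (h1 v h w h')
  have h2 := fun h h' => hne (h2 v h w h')
  have h3 := fun h h' => hne (h3 v h w h')
  simp only [Finset.mem_inter] at h1 h2 h3
  simp only [hvw, true_and]
  by_cases hA : v ∈ A ∧ w ∈ A
  · rw [if_pos hA, if_neg (fun h => h1 ⟨hA.1, h.1⟩ ⟨hA.2, h.2⟩),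
      if_neg (fun h => h2 ⟨hA.1, h.1⟩ ⟨hA.2, h.2⟩),
      if_pos ⟨Or.inl (Or.inl hA.1), Or.inl (Or.inl hA.2)⟩]; norm_num
  rw [if_neg hA]
  by_cases hB : v ∈ B ∧ w ∈ B
  · rw [if_pos hB, if_neg (fun h => h3 ⟨hB.1, h.1⟩ ⟨hB.2, h.2⟩),
      if_pos ⟨Or.inl (Or.inr hB.1), Or.inl (Or.inr hB.2)⟩]; norm_num
  rw [if_neg hB]
  by_cases hC : v ∈ C ∧ w ∈ C
  · rw [if_pos hC, if_pos ⟨Or.inr hC.1, Or.inr hC.2⟩]; norm_num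
  rw [if_neg hC]
  split_ifs <;> norm_num

lemma dg_card (F : SimpleGraph V) (v : V) (S : Finset V) :
    dg F v S = (Finset.univ.filter fun w => F.Adj v w ∧ w ∈ S).card := by
  unfold dg
  rw [Finset.card_filter]; push_cast; rfl

lemma dd_card (F : SimpleGraph V) (S : Finset V) :
    dd F S = (Finset.univ.filter fun z : V × V => F.Adj z.1 z.2 ∧ z.1 ∈ S ∧ z.2 ∈ S).card := by
  unfold dd
  rw [Finset.card_filter, Fintype.sum_prod_type]; push_cast; rfl

lemma dg_ge (F : SimpleGraph V) (v : V) (S P : Finset V) (h : ∀ w ∈ P, F.Adj v w ∧ w ∈ S) :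
    (P.card : ℤ) ≤ dg F v S := by
  rw [dg_card]
  exact_mod_cast Finset.card_le_card fun w hw => by simpa using h w hw

lemma dd_pair (F : SimpleGraph V) {a b : V} (h : F.Adj a b) : 2 ≤ dd F {a, b} := by
  rw [dd_insert F (by simpa using h.ne)]
  have := dg_ge F a {b} {b} (by simpa using h)
  have := dd_nonneg F {b}
  simp at *; linarith

lemma dd_sum (F : SimpleGraph V) : dd F Finset.univ = ∑ v, dg F v Finset.univ := by
  simp [dd, dg]

lemma card_ui (A B : Finset V) : ((A ∪ B).card : ℤ) + (A ∩ B).card = A.card + B.card := by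
  exact_mod_cast Finset.card_union_add_card_inter A B

lemma Sparse.mono {l : ℤ} {F F' : SimpleGraph V} (h : F ≤ F') (hs : Sparse l F') : Sparse l F :=
  fun S hS => (dd_le fun v w h1 h2 h3 => ⟨h h1, h2, h3⟩).trans (hs S hS)

lemma tight_union {l : ℤ} {F : SimpleGraph V} (hs : Sparse l F) {A B : Finset V}
    (hA : Tight l F A) (hB : Tight l F B) (h : 2 ≤ (A ∩ B).card ∨ (l = 2 ∧ 1 ≤ (A ∩ B).card)) :
    Tight l F (A ∪ B) := by
  have hc : 2 ≤ (A ∪ B).card := hA.1.trans (Finset.card_le_card Finset.subset_union_left)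
  refine ⟨hc, le_antisymm (hs _ hc) ?_⟩
  have h1 := dd_super F A B
  have h2 := card_ui A B
  have hA2 := hA.2
  have hB2 := hB.2
  by_cases h3 : 2 ≤ (A ∩ B).card
  · have := hs _ h3
    linarith
  · have h4 : l = 2 ∧ 1 ≤ (A ∩ B).card := by tauto
    have h5 : ((A ∩ B).card : ℤ) = 1 := by omega
    rw [dd_small F (S := A ∩ B) (by omega)] at h1
    linarith

lemma tri {l : ℤ} (hl : l = 2 ∨ l = 3) {F : SimpleGraph V} (hs : Sparse l F) {A B C : Finset V}
    {a b c : V} (hac : a ≠ c)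
    (hA : Tight l F A) (hB : Tight l F B) (hC : Tight l F C)
    (haA : a ∈ A) (hbA : b ∈ A) (hbB : b ∈ B) (hcB : c ∈ B) (hcC : c ∈ C) (haC : a ∈ C) :
    ∃ T, Tight l F T ∧ a ∈ T ∧ b ∈ T ∧ c ∈ T := by
  have p1 : 1 ≤ (A ∩ B).card := Finset.card_pos.2 ⟨b, by simp [*]⟩
  have p2 : 1 ≤ (A ∩ C).card := Finset.card_pos.2 ⟨a, by simp [*]⟩
  have p3 : 1 ≤ (B ∩ C).card := Finset.card_pos.2 ⟨c, by simp [*]⟩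
  by_cases h1 : 2 ≤ (A ∩ B).card ∨ (l = 2 ∧ 1 ≤ (A ∩ B).card)
  · exact ⟨_, tight_union hs hA hB h1, by simp [*], by simp [*], by simp [*]⟩
  by_cases h2 : 2 ≤ (A ∩ C).card ∨ (l = 2 ∧ 1 ≤ (A ∩ C).card)
  · exact ⟨_, tight_union hs hA hC h2, by simp [*], by simp [*], by simp [*]⟩
  by_cases h3 : 2 ≤ (B ∩ C).card ∨ (l = 2 ∧ 1 ≤ (B ∩ C).card)
  · exact ⟨_, tight_union hs hB hC h3, by simp [*], by simp [*], by simp [*]⟩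
  have hl3 : l = 3 := by tauto
  subst hl3
  have hc : 2 ≤ (A ∪ B ∪ C).card := hA.1.trans
    (Finset.card_le_card (Finset.subset_union_left.trans Finset.subset_union_left))
  refine ⟨A ∪ B ∪ C, ⟨hc, le_antisymm (hs _ hc) ?_⟩, by simp [*], by simp [*], by simp [*]⟩
  have k := dd_three F (A := A) (B := B) (C := C) (by omega) (by omega) (by omega)
  have k1 := card_ui A B
  have k2 := card_ui (A ∪ B) C
  have k3 : ((A ∪ B) ∩ C).card = 2 := by
    apply le_antisymm
    · rw [Finset.union_inter_distrib_right]
      refine (Finset.card_union_le _ _).trans ?_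
      omega
    · rw [← Finset.card_pair hac]
      apply Finset.card_le_card
      intro z; simp only [Finset.mem_insert, Finset.mem_singleton]
      rintro (rfl | rfl) <;> simp [*]
  have := hA.2
  have := hB.2
  have := hC.2
  omega

lemma dd_edge' (F F' : SimpleGraph V) {v w : V} (S : Finset V)
    (hF : ∀ a b, F'.Adj a b → F.Adj a b ∨ (a = v ∧ b = w) ∨ (a = w ∧ b = v)) :
    dd F' S ≤ dd F S + 2 := by
  have h : ∀ a b, (if F'.Adj a b ∧ a ∈ S ∧ b ∈ S then (1 : ℤ) else 0) ≤
      (if F.Adj a b ∧ a ∈ S ∧ b ∈ S then 1 else 0) + (if a = v then (if b = w then 1 else 0) else 0)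
      + (if a = w then (if b = v then 1 else 0) else 0) := by
    intro a b
    have := hF a b
    split_ifs <;> first | omega | tauto
  refine (Finset.sum_le_sum fun a _ => Finset.sum_le_sum fun b _ => h a b).trans ?_
  simp only [Finset.sum_add_distrib]
  unfold dd
  have e1 : ∀ v w : V, ∑ a : V, ∑ b : V, (if a = v then (if b = w then (1 : ℤ) else 0) else 0) = 1 := by
    intro v w
    rw [Finset.sum_comm]
    simp
  rw [e1, e1]; linarith

lemma dd_edge (F : SimpleGraph V) {v w : V} (S : Finset V) :
    dd (F ⊔ SimpleGraph.edge v w) S ≤ dd F S + 2 :=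
  dd_edge' F _ (v := v) (w := w) S fun a b h => by
    rw [SimpleGraph.sup_adj, SimpleGraph.edge_adj] at h; tauto

lemma sparse_edge {l : ℤ} {F : SimpleGraph V} (hs : Sparse l F) {v w : V}
    (h : ∀ T, Tight l F T → v ∈ T → w ∉ T) : Sparse l (F ⊔ SimpleGraph.edge v w) := by
  intro S hS
  by_cases hvw : v ∈ S ∧ w ∈ S
  · have h1 : dd F S ≠ 4 * S.card - 2 * l := fun h1 => h S ⟨hS, h1⟩ hvw.1 hvw.2
    have h2 := hs S hS
    obtain ⟨k, hk⟩ := dd_even F S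
    have := dd_edge F (v := v) (w := w) S
    omega
  · refine le_trans (dd_le fun a b h1 h2 h3 => ⟨?_, h2, h3⟩) (hs S hS)
    rw [SimpleGraph.sup_adj, SimpleGraph.edge_adj] at h1
    rcases h1 with h1 | ⟨⟨rfl, rfl⟩ | ⟨rfl, rfl⟩, _⟩ <;> tauto

lemma dd_del (F : SimpleGraph V) (v : V) (S : Finset V) : dd (del F v) S = dd F (S.erase v) := by
  apply le_antisymm <;> refine dd_le fun a b h1 h2 h3 => ?_
  · exact ⟨h1.1, by simp [h1.2.1, h2], by simp [h1.2.2, h3]⟩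
  · rw [Finset.mem_erase] at h2 h3
    exact ⟨⟨h1, h2.1, h3.1⟩, h2.2, h3.2⟩

lemma del_le (F : SimpleGraph V) (v : V) : del F v ≤ F := fun _ _ h => h.1

lemma dd_univ_del (F : SimpleGraph V) (v : V) :
    dd F Finset.univ = dd (del F v) Finset.univ + 2 * dg F v Finset.univ := by
  have h := dd_insert F (Finset.notMem_erase v Finset.univ)
  rw [Finset.insert_erase (Finset.mem_univ v)] at h
  rw [h, dd_del]
  congr 2
  unfold dg
  refine Finset.sum_congr rfl fun w _ => ?_
  by_cases hw : F.Adj v w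
  · simp [hw, hw.ne.symm]
  · simp [hw]

lemma tight_del {l : ℤ} {F : SimpleGraph V} (hs : Sparse l F) {v x y : V}
    (hx : x ≠ v) (hy : y ≠ v)
    (hxy : x ≠ y) {T : Finset V} (hT : Tight l (del F v) T) (hxT : x ∈ T) (hyT : y ∈ T) :
    v ∉ T ∧ Tight l F T := by
  have hv : v ∉ T := by
    intro hv
    have h1 : 2 ≤ (T.erase v).card := by
      rw [← Finset.card_pair hxy]
      apply Finset.card_le_card
      intro z; simp only [Finset.mem_insert, Finset.mem_singleton]
      rintro (rfl | rfl) <;> simp [*]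
    have h2 := hs _ h1
    rw [← dd_del, hT.2] at h2
    have := Finset.card_erase_of_mem hv
    omega
  refine ⟨hv, hT.1, ?_⟩
  have := hT.2
  rwa [dd_del, Finset.erase_eq_of_notMem hv] at this

lemma exists_low (F : SimpleGraph V) {l : ℤ} (hl : 0 < l) (hs : Sparse l F) {a b : V}
    (hab : F.Adj a b) : ∃ v, 1 ≤ dg F v Finset.univ ∧ dg F v Finset.univ ≤ 3 := by
  by_contra! hcon
  let S : Finset V := Finset.univ.filter fun v => 1 ≤ dg F v Finset.univ
  have hmem : ∀ v w, F.Adj v w → v ∈ S := by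
    intro v w h
    simp only [S, Finset.mem_filter, Finset.mem_univ, true_and]
    simpa using dg_ge F v Finset.univ {w} (by simpa using h)
  have h2 : 2 ≤ S.card := by
    rw [← Finset.card_pair hab.ne]
    apply Finset.card_le_card
    intro z; simp only [Finset.mem_insert, Finset.mem_singleton]
    rintro (rfl | rfl)
    · exact hmem _ _ hab
    · exact hmem _ _ hab.symm
  have h3 := hs S h2
  have h4 : dd F Finset.univ ≤ dd F S :=
    dd_le fun v w h _ _ => ⟨h, hmem v w h, hmem w v h.symm⟩
  rw [dd_sum] at h4
  have h5 : ∑ v ∈ S, (4 : ℤ) ≤ ∑ v, dg F v Finset.univ := by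
    refine le_trans (Finset.sum_le_sum fun v hv => ?_)
      (Finset.sum_le_sum_of_subset_of_nonneg (Finset.subset_univ S) fun v _ _ => dg_nonneg F v _)
    have := hcon v (by simpa [S] using hv)
    omega
  rw [Finset.sum_const, nsmul_eq_mul] at h5
  linarith

lemma ctr_sparse {F : SimpleGraph V} (hs : Sparse 2 F) {T : Finset V} {t0 : V} (ht0 : t0 ∈ T)
    (hT : Tight 2 F T) : Sparse 2 (ctr F T t0) ∧
      dd (ctr F T t0) Finset.univ < dd F Finset.univ := by
  have key : ∀ S, t0 ∈ S → dd (ctr F T t0) S + dd F T ≤ dd F (S ∪ T) := by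
    intro S hS
    rw [dd_card, dd_card, dd_card]
    let f : V → V := fun v => if v ∈ T then t0 else v
    let P := Finset.univ.filter fun z : V × V => F.Adj z.1 z.2 ∧ z.1 ∈ S ∪ T ∧ z.2 ∈ S ∪ T
    let Q := Finset.univ.filter fun z : V × V => F.Adj z.1 z.2 ∧ z.1 ∈ T ∧ z.2 ∈ T
    let R := Finset.univ.filter
      fun z : V × V => (ctr F T t0).Adj z.1 z.2 ∧ z.1 ∈ S ∧ z.2 ∈ S
    have hQP : Q ⊆ P := by
      intro z hz
      simp only [Q, P, Finset.mem_filter, Finset.mem_univ, true_and, Finset.mem_union] at hz ⊢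
      tauto
    have hR : R ⊆ (P \ Q).image (fun z => (f z.1, f z.2)) := by
      rintro ⟨a, b⟩ hz
      simp only [R, Finset.mem_filter, Finset.mem_univ, true_and] at hz
      obtain ⟨⟨hab, v, w, hvw, hv, hw⟩, ha, hb⟩ := hz
      rw [Finset.mem_image]
      refine ⟨(v, w), ?_, by simp only [f]; rw [hv, hw]⟩
      simp only [Q, P, Finset.mem_sdiff, Finset.mem_filter, Finset.mem_univ, true_and, Finset.mem_union]
      refine ⟨⟨hvw, ?_, ?_⟩, ?_⟩
      · by_cases h : v ∈ T
        · exact Or.inr h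
        · rw [if_neg h] at hv; rw [hv]; exact Or.inl ha
      · by_cases h : w ∈ T
        · exact Or.inr h
        · rw [if_neg h] at hw; rw [hw]; exact Or.inl hb
      · rintro ⟨_, h1, h2⟩
        rw [if_pos h1] at hv
        rw [if_pos h2] at hw
        exact hab (hv.symm.trans hw)
    have h1 := (Finset.card_le_card hR).trans Finset.card_image_le
    have h2 := Finset.card_sdiff_add_card_eq_card hQP
    change (R.card : ℤ) + Q.card ≤ P.card
    omega
  refine ⟨fun S hS => ?_, ?_⟩
  · by_cases h : t0 ∈ S
    · have h1 := key S h
      have h2 := hs (S ∪ T) (hT.1.trans (Finset.card_le_card Finset.subset_union_right))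
      have h3 := hT.2
      have h4 := card_ui S T
      have h5 : 1 ≤ (S ∩ T).card := Finset.card_pos.2 ⟨t0, by simp [*]⟩
      omega
    · refine le_trans (dd_le ?_) (hs S hS)
      rintro a b ⟨hab, v, w, hvw, hv, hw⟩ ha hb
      refine ⟨?_, ha, hb⟩
      split_ifs at hv hw
      · exact absurd (hv ▸ ha) h
      · exact absurd (hv ▸ ha) h
      · exact absurd (hw ▸ hb) h
      · rwa [← hv, ← hw]
  · have h1 := key Finset.univ (Finset.mem_univ _)
    have h2 := hT.2
    have h3 := hT.1
    have h0 : Finset.univ ∪ T = Finset.univ := Finset.union_eq_left.2 (Finset.subset_univ T)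
    rw [h0] at h1
    omega

end comb



lemma nbrs_card [Fintype V] (F : SimpleGraph V) (v : V) :
    dg F v Finset.univ = (Finset.univ.filter fun w => F.Adj v w).card := by
  rw [dg_card]; simp

lemma laman [Fintype V] {q : ℝ} (hq : 1 < q) {l : ℤ} (hl : l = 3 ∨ (l = 2 ∧ q ≠ 2)) :
    ∀ (n : ℕ) (F : SimpleGraph V), dd F Finset.univ ≤ n → Sparse l F → Ind q F := by
  intro n
  induction n with
  | zero =>
    intro F hn _
    refine ⟨fun _ _ => 0, fun ω _ => ⟨fun _ _ => 0, fun v w h => ?_⟩⟩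
    have h1 := dd_pair F h
    have h2 : dd F {v, w} ≤ dd F Finset.univ := dd_le fun a b h _ _ => ⟨h, by simp, by simp⟩
    exfalso
    push_cast at hn; linarith
  | succ n ih =>
    intro F hn hs
    by_cases hE : ∀ a b, ¬ F.Adj a b
    · refine ⟨fun _ _ => 0, fun ω _ => ⟨fun _ _ => 0, fun v w h => absurd h (hE v w)⟩⟩
    push Not at hE
    obtain ⟨a0, b0, hab0⟩ := hE
    push_cast at hn
    obtain ⟨v, hv1, hv3⟩ := exists_low F (by omega) hs hab0
    have hdel : ∀ v, 1 ≤ dg F v Finset.univ → Ind q (del F v) := fun v hv => by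
      apply ih _ _ (hs.mono (del_le F v))
      have := dd_univ_del F v
      linarith
    have hnb : ∀ w, w ∈ (Finset.univ.filter fun w => F.Adj v w) ↔ F.Adj v w := by simp
    rw [nbrs_card] at hv1 hv3
    by_cases hd1 : (Finset.univ.filter fun w => F.Adj v w).card = 1
    · obtain ⟨a, ha⟩ := Finset.card_eq_one.1 hd1
      simp only [ha, Finset.mem_singleton] at hnb
      exact ext_one hq ((hnb a).1 rfl).ne (fun w hw => (hnb w).2 hw)
        (hdel v (by rw [nbrs_card]; exact hv1))
    by_cases hd2 : (Finset.univ.filter fun w => F.Adj v w).card = 2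
    · obtain ⟨a, b, hab, ha⟩ := Finset.card_eq_two.1 hd2
      simp only [ha, Finset.mem_insert, Finset.mem_singleton] at hnb
      exact ext_two hq ((hnb a).1 (by simp)).ne ((hnb b).1 (by simp)).ne hab
        (fun w hw => (hnb w).2 hw) (hdel v (by rw [nbrs_card]; exact hv1))
    have hd3 : (Finset.univ.filter fun w => F.Adj v w).card = 3 := by omega
    obtain ⟨a, b, c, hab, hac, hbc, ha⟩ := Finset.card_eq_three.1 hd3
    have hdg : dg F v Finset.univ = 3 := by rw [nbrs_card, hd3]; rfl
    simp only [ha, Finset.mem_insert, Finset.mem_singleton] at hnb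
    have hva := (hnb a).1 (by simp)
    have hvb := (hnb b).1 (by simp)
    have hvc := (hnb c).1 (by simp)
    have hsD := hs.mono (del_le F v)
    -- the 1-extension step
    have step : ∀ x y z, F.Adj v x → F.Adj v y → F.Adj v z → x ≠ y → x ≠ z → y ≠ z →
        (∀ w, F.Adj v w → w = x ∨ w = y ∨ w = z) → ¬ F.Adj x y →
        (∀ T, Tight l (del F v) T → x ∈ T → y ∉ T) → Ind q F := by
      intro x y z hx hy hz hxy hxz hyz hn3 hnxy hT
      refine ext_three hq hx.ne hy.ne hz.ne hxy hxz hyz hnxy hn3 (ih _ ?_ (sparse_edge hsD hT))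
      have h1 := dd_univ_del F v
      have h2 := dd_edge (del F v) (v := x) (w := y) Finset.univ
      linarith
    rcases hl with rfl | ⟨rfl, hq2⟩
    · have step' : ∀ x y z, F.Adj v x → F.Adj v y → F.Adj v z → x ≠ y → x ≠ z → y ≠ z →
          (∀ w, F.Adj v w → w = x ∨ w = y ∨ w = z) → ¬ Ind q F →
          ∃ T, Tight 3 (del F v) T ∧ x ∈ T ∧ y ∈ T := by
        intro x y z hx hy hz hxy hxz hyz hn3 hI
        by_contra! hcon
        refine hI (step x y z hx hy hz hxy hxz hyz hn3 (fun hadj => ?_) hcon)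
        have hc2 : ({x, y} : Finset V).card = 2 := Finset.card_pair hxy
        refine hcon {x, y} ⟨hc2.ge, le_antisymm (hsD _ hc2.ge) ?_⟩ (by simp) (by simp)
        rw [hc2]
        have := dd_pair (del F v) (a := x) (b := y) ⟨hadj, hx.ne.symm, hy.ne.symm⟩
        push_cast; linarith
      by_contra hI
      obtain ⟨A, hA, haA, hbA⟩ := step' a b c hva hvb hvc hab hac hbc (fun w hw => (hnb w).2 hw) hI
      obtain ⟨B, hB, hbB, hcB⟩ := step' b c a hvb hvc hva hbc hab.symm hac.symm
        (fun w hw => by have := (hnb w).2 hw; tauto) hI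
      obtain ⟨C, hC, hcC, haC⟩ := step' c a b hvc hva hvb hac.symm hbc.symm hab
        (fun w hw => by have := (hnb w).2 hw; tauto) hI
      obtain ⟨T, hT, haT, hbT, hcT⟩ := tri (Or.inr rfl) hsD hac hA hB hC haA hbA hbB hcB hcC haC
      obtain ⟨hvT, hT'⟩ := tight_del hs hva.ne.symm hvb.ne.symm hab hT haT hbT
      have h1 := dd_insert F hvT
      have h2 := dg_ge F v T {a, b, c} (by
        intro w hw
        simp only [Finset.mem_insert, Finset.mem_singleton] at hw
        rcases hw with rfl | rfl | rfl
        · exact ⟨hva, haT⟩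
        · exact ⟨hvb, hbT⟩
        · exact ⟨hvc, hcT⟩)
      rw [Finset.card_eq_three.2 ⟨a, b, c, hab, hac, hbc, rfl⟩] at h2
      have h3 := hs (insert v T) (by rw [Finset.card_insert_of_notMem hvT]; have := hT.1; omega)
      rw [Finset.card_insert_of_notMem hvT, h1, hT'.2] at h3
      push_cast at h2 h3
      linarith
    · by_cases hP : ∃ T, Tight 2 F T ∧ ∃ s t, F.Adj s t ∧ s ∉ T
      · let P : Finset (Finset V) :=
          Finset.univ.filter fun T => Tight 2 F T ∧ ∃ s t, F.Adj s t ∧ s ∉ T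
        obtain ⟨T, hTP, hmax⟩ := Finset.exists_max_image P Finset.card
          (by obtain ⟨T, hT⟩ := hP; exact ⟨T, by simpa [P] using hT⟩)
        simp only [P, Finset.mem_filter, Finset.mem_univ, true_and] at hTP hmax
        obtain ⟨hT, s, t, hst, hsT⟩ := hTP
        by_cases huniq : ∀ o t t', o ∉ T → t ∈ T → t' ∈ T → F.Adj o t → F.Adj o t' → t = t'
        · obtain ⟨t0, ht0⟩ : T.Nonempty := Finset.card_pos.1 (by have := hT.1; omega)
          obtain ⟨hc1, hc2⟩ := ctr_sparse hs ht0 hT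
          refine ind_ctr hq ht0 huniq (ih _ ?_ (hs.mono fun _ _ h => h.1)) (ih _ (by linarith) hc1)
          have : dd (res F T) Finset.univ < dd F Finset.univ := dd_lt (a := s) (b := t)
            (fun a b h _ _ => ⟨h.1, by simp, by simp⟩) ⟨hst, by simp, by simp⟩
            (fun h => hsT h.1.2.1)
          linarith
        · push Not at huniq
          obtain ⟨o, t, t', hoT, htT, ht'T, hot, hot', htt⟩ := huniq
          have h1 := dd_insert F hoT
          have h2 := dg_ge F o T {t, t'} (by
            intro w hw
            simp only [Finset.mem_insert, Finset.mem_singleton] at hw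
            rcases hw with rfl | rfl
            · exact ⟨hot, htT⟩
            · exact ⟨hot', ht'T⟩)
          rw [Finset.card_pair htt] at h2
          have hc := Finset.card_insert_of_notMem hoT
          have h3 : 2 ≤ (insert o T).card := by have := hT.1; omega
          have h4 := hs _ h3
          have h5 := hT.2
          have hto : Tight 2 F (insert o T) := ⟨h3, by rw [hc] at h4 ⊢; push_cast at h2 h4 ⊢; linarith⟩
          have hin : ∀ x y, F.Adj x y → x ∈ insert o T := by
            intro x y hxy
            by_contra hx
            have := hmax (insert o T) ⟨hto, x, y, hxy, hx⟩
            omega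
          have hdo : dg F o T = 2 := by
            rw [hc] at h4; push_cast at h2 h4; linarith
          have hnbo : ∀ w, F.Adj o w → w = t ∨ w = t' := by
            intro w hw
            by_contra! hne
            have hwT : w ∈ T := by
              rcases Finset.mem_insert.1 (hin w o hw.symm) with h | h
              · exact absurd h hw.ne.symm
              · exact h
            have := dg_ge F o T {t, t', w} (by
              intro x hx
              simp only [Finset.mem_insert, Finset.mem_singleton] at hx
              rcases hx with rfl | rfl | rfl
              · exact ⟨hot, htT⟩
              · exact ⟨hot', ht'T⟩
              · exact ⟨hw, hwT⟩)
            rw [Finset.card_eq_three.2 ⟨t, t', w, htt, hne.1.symm, hne.2.symm, rfl⟩, hdo] at this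
            norm_num at this
          refine ext_two hq hot.ne hot'.ne htt hnbo (hdel o ?_)
          exact_mod_cast dg_ge F o Finset.univ {t} (by simpa using hot)
      · push Not at hP
        have step' : ∀ x y z, F.Adj v x → F.Adj v y → F.Adj v z → x ≠ y → x ≠ z → y ≠ z →
            (∀ w, F.Adj v w → w = x ∨ w = y ∨ w = z) → ¬ Ind q F → F.Adj x y := by
          intro x y z hx hy hz hxy hxz hyz hn3 hI
          by_contra hadj
          refine hI (step x y z hx hy hz hxy hxz hyz hn3 hadj fun T hT hxT hyT => ?_)
          obtain ⟨hvT, hT'⟩ := tight_del hs hx.ne.symm hy.ne.symm hxy hT hxT hyT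
          exact hvT (hP T hT' v x hx)
        by_contra hI
        have kab := step' a b c hva hvb hvc hab hac hbc (fun w hw => (hnb w).2 hw) hI
        have kbc := step' b c a hvb hvc hva hbc hab.symm hac.symm
          (fun w hw => by have := (hnb w).2 hw; tauto) hI
        have kca := step' c a b hvc hva hvb hac.symm hbc.symm hab
          (fun w hw => by have := (hnb w).2 hw; tauto) hI
        apply hI
        have hvn : v ∉ ({a, b, c} : Finset V) := by simp [hva.ne, hvb.ne, hvc.ne]
        have han : a ∉ ({b, c} : Finset V) := by simp [hab, hac]
        have h1 := dd_insert F hvn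
        have h2 := dd_insert F han
        have h3 := dd_pair F kbc
        have h4 := dg_ge F v {a, b, c} {a, b, c} (by
          intro w hw
          refine ⟨?_, hw⟩
          simp only [Finset.mem_insert, Finset.mem_singleton] at hw
          rcases hw with rfl | rfl | rfl <;> assumption)
        have h5 := dg_ge F a {b, c} {b, c} (by
          intro w hw
          refine ⟨?_, hw⟩
          simp only [Finset.mem_insert, Finset.mem_singleton] at hw
          rcases hw with rfl | rfl
          · exact kab
          · exact kca.symm)
        rw [Finset.card_eq_three.2 ⟨a, b, c, hab, hac, hbc, rfl⟩] at h4
        rw [Finset.card_pair hbc] at h5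
        have hc4 : (insert v ({a, b, c} : Finset V)).card = 4 := by
          rw [Finset.card_insert_of_notMem hvn, Finset.card_eq_three.2 ⟨a, b, c, hab, hac, hbc, rfl⟩]
        have hT4 : Tight 2 F (insert v ({a, b, c} : Finset V)) := by
          refine ⟨by omega, le_antisymm (hs _ (by omega)) ?_⟩
          rw [hc4]; push_cast at h4 h5 ⊢; linarith
        refine ind_K4 hq hq2 hva.ne hvb.ne hvc.ne hab hac hbc fun s t hst => ?_
        simpa using hP _ hT4 s t hst

lemma laman' [Fintype V] {q : ℝ} (hq : 1 < q) {l : ℤ} (hl : l = 3 ∨ (l = 2 ∧ q ≠ 2))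
    {F : SimpleGraph V} (hs : Sparse l F) : Ind q F :=
  laman hq hl (dd F Finset.univ).toNat F (by rw [Int.toNat_of_nonneg (dd_nonneg F _)]) hs



lemma hasDerivAt_abs_phi {q : ℝ} (hq : 1 < q) (x : ℝ) :
    HasDerivAt (fun y : ℝ => |y| ^ q) (q * phi q x) x := by
  have h := hasDerivAt_abs_rpow x hq
  convert h using 1
  rw [mul_assoc]
  congr 1
  rcases lt_trichotomy x 0 with hx | rfl | hx
  · rw [phi, Real.sign_of_neg hx, abs_of_neg hx, show q - 1 = (q - 2) + 1 by ring,
      Real.rpow_add (by linarith), Real.rpow_one]; ring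
  · simp [phi_zero]
  · rw [phi_of_pos q hx, abs_of_pos hx, show q - 1 = (q - 2) + 1 by ring,
      Real.rpow_add hx, Real.rpow_one]

lemma flex_iff {q : ℝ} (hq : 1 < q) {p u : V → Fin 2 → ℝ} {v w : V} (h : p v ≠ p w) :
    ((fun t : ℝ => qnorm q ((p v + t • u v) - (p w + t • u w)) - qnorm q (p v - p w))
      =o[𝓝 (0 : ℝ)] (fun t : ℝ => t)) ↔ sig (Nq q p) u v w = 0 := by
  have hS : HasDerivAt (fun t : ℝ => ∑ i, |((p v + t • u v) - (p w + t • u w)) i| ^ q)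
      (q * sig (Nq q p) u v w) 0 := by
    have hi : ∀ i : Fin 2, HasDerivAt (fun t : ℝ => |((p v + t • u v) - (p w + t • u w)) i| ^ q)
        (q * phi q (p v i - p w i) * (u v i - u w i)) 0 := by
      intro i
      have h1 : HasDerivAt (fun t : ℝ => ((p v + t • u v) - (p w + t • u w)) i)
          (u v i - u w i) 0 := by
        simp only [Pi.sub_apply, Pi.add_apply, Pi.smul_apply, smul_eq_mul]
        have := (((hasDerivAt_id (0 : ℝ)).mul_const (u v i)).const_add (p v i)).fun_sub
          (((hasDerivAt_id (0 : ℝ)).mul_const (u w i)).const_add (p w i))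
        simpa using this
      have h2 := hasDerivAt_abs_phi hq (p v i - p w i)
      have h3 : ((p v + (0 : ℝ) • u v) - (p w + (0 : ℝ) • u w)) i = p v i - p w i := by simp
      rw [← h3] at h2
      have := HasDerivAt.comp (0 : ℝ) h2 h1
      rw [h3] at this
      exact this
    have h4 := HasDerivAt.fun_sum (u := Finset.univ) (fun i _ => hi i)
    have he : q * sig (Nq q p) u v w = ∑ i : Fin 2, q * phi q (p v i - p w i) * (u v i - u w i) := by
      simp only [sig, Nq, rigidityCoef_eq, Fin.sum_univ_two]; ring
    rw [he]
    exact h4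
  have hpos : 0 < ∑ i, |(p v - p w) i| ^ q := by
    obtain ⟨i, hi⟩ := Function.ne_iff.1 h
    refine Finset.sum_pos' (fun i _ => Real.rpow_nonneg (abs_nonneg _) _) ⟨i, Finset.mem_univ _, ?_⟩
    exact Real.rpow_pos_of_pos (abs_pos.2 (sub_ne_zero.2 hi)) _
  have h0 : (p v + (0 : ℝ) • u v) - (p w + (0 : ℝ) • u w) = p v - p w := by simp
  have hD := hS.rpow_const (p := 1 / q) (Or.inl (by rw [h0]; exact hpos.ne'))
  rw [h0] at hD
  set K : ℝ := q * sig (Nq q p) u v w * (1 / q) * (∑ i, |(p v - p w) i| ^ q) ^ (1 / q - 1) with hK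
  have hiff : ((fun t : ℝ => qnorm q ((p v + t • u v) - (p w + t • u w)) - qnorm q (p v - p w))
      =o[𝓝 (0 : ℝ)] (fun t : ℝ => t)) ↔
      HasDerivAt (fun t : ℝ => qnorm q ((p v + t • u v) - (p w + t • u w))) 0 0 := by
    rw [hasDerivAt_iff_isLittleO]
    simp only [h0, sub_zero, smul_zero]
  rw [hiff]
  have hq0 : q ≠ 0 := by linarith
  have hpne := (Real.rpow_pos_of_pos hpos (1 / q - 1)).ne'
  constructor
  · intro h1
    have h2 : K = 0 := hD.unique h1
    rw [hK] at h2
    rw [mul_eq_zero, or_iff_left hpne, mul_eq_zero, or_iff_left (one_div_ne_zero hq0), mul_eq_zero,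
      or_iff_right hq0] at h2
    exact h2
  · intro h1
    have : K = 0 := by rw [hK, h1]; simp
    rw [this] at hD
    exact hD

lemma mot {q : ℝ} (hq : 1 < q) {p u : V → Fin 2 → ℝ} {S : Set V} (h : IsQTrivialOn q p S u)
    {v w : V} (hv : v ∈ S) (hw : w ∈ S) : sig (Nq q p) u v w = 0 := by
  obtain ⟨γ, ⟨Γ, ⟨hiso, _, h0⟩, hd⟩, hu⟩ := h
  have hS : HasDerivWithinAt (fun t : ℝ => ∑ i, |(Γ (p v) t - Γ (p w) t) i| ^ q)
      (q * sig (Nq q p) u v w) (Icc (-1) 1) 0 := by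
    have hi : ∀ i : Fin 2, HasDerivWithinAt (fun t : ℝ => |(Γ (p v) t - Γ (p w) t) i| ^ q)
        (q * phi q (p v i - p w i) * (u v i - u w i)) (Icc (-1) 1) 0 := by
      intro i
      have h1 : HasDerivWithinAt (fun t : ℝ => (Γ (p v) t - Γ (p w) t) i)
          (u v i - u w i) (Icc (-1) 1) 0 := by
        rw [hu v hv, hu w hw]
        exact (hasDerivWithinAt_pi.1 (hd (p v)) i).sub (hasDerivWithinAt_pi.1 (hd (p w)) i)
      have h2 := hasDerivAt_abs_phi hq (p v i - p w i)
      have h3 : (Γ (p v) 0 - Γ (p w) 0) i = p v i - p w i := by simp [h0]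
      rw [← h3] at h2
      have := HasDerivAt.comp_hasDerivWithinAt (0 : ℝ) h2 h1
      rw [h3] at this
      exact this
    have h4 := HasDerivWithinAt.fun_sum (u := Finset.univ) (fun i _ => hi i)
    have he : q * sig (Nq q p) u v w = ∑ i : Fin 2, q * phi q (p v i - p w i) * (u v i - u w i) := by
      simp only [sig, Nq, rigidityCoef_eq, Fin.sum_univ_two]; ring
    rw [he]
    exact h4
  have hq0 : q ≠ 0 := by linarith
  have hnn : ∀ x : Fin 2 → ℝ, 0 ≤ ∑ i, |x i| ^ q := fun x =>
    Finset.sum_nonneg fun i _ => Real.rpow_nonneg (abs_nonneg _) _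
  have hc : ∀ t ∈ Icc (-1 : ℝ) 1, ∑ i, |(Γ (p v) t - Γ (p w) t) i| ^ q =
      ∑ i, |(p v - p w) i| ^ q := by
    intro t ht
    have := hiso t ht (p v) (p w)
    unfold qnorm at this
    exact (Real.rpow_left_inj (hnn _) (hnn _) (one_div_ne_zero hq0)).1 this
  have hmem : (0 : ℝ) ∈ Icc (-1 : ℝ) 1 := by constructor <;> norm_num
  have hC : HasDerivWithinAt (fun t : ℝ => ∑ i, |(Γ (p v) t - Γ (p w) t) i| ^ q) 0 (Icc (-1) 1) 0 :=
    (hasDerivWithinAt_const (0 : ℝ) (Icc (-1 : ℝ) 1) (∑ i, |(p v - p w) i| ^ q)).congr hc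
      (hc 0 hmem)
  have hun : UniqueDiffWithinAt ℝ (Icc (-1 : ℝ) 1) 0 :=
    uniqueDiffOn_Icc (by norm_num) 0 hmem
  have := hun.eq_deriv _ hS hC
  simpa [hq0] using this

lemma triv_const {q : ℝ} {p u : V → Fin 2 → ℝ} {S : Set V} (c : Fin 2 → ℝ)
    (h : ∀ v ∈ S, u v = c) : IsQTrivialOn q p S u := by
  refine ⟨fun _ => c, ⟨fun x t => x + t • c, ⟨fun t _ x y => by simp, fun x => by fun_prop,
    fun x => by simp⟩, fun x => ?_⟩, h⟩
  have := (((hasDerivAt_id (0 : ℝ)).smul_const c).const_add x).hasDerivWithinAt (s := Icc (-1) 1)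
  simpa using this

lemma triv_rot {p u : V → Fin 2 → ℝ} {S : Set V} (c : Fin 2 → ℝ) (θ : ℝ)
    (h : ∀ v ∈ S, u v = ![c 0 - θ * p v 1, c 1 + θ * p v 0]) : IsQTrivialOn 2 p S u := by
  refine ⟨fun x => ![c 0 - θ * x 1, c 1 + θ * x 0],
    ⟨fun x t => ![t * c 0 + (Real.cos (θ * t) * x 0 - Real.sin (θ * t) * x 1),
      t * c 1 + (Real.sin (θ * t) * x 0 + Real.cos (θ * t) * x 1)],
    ⟨fun t _ x y => ?_, fun x => ?_, fun x => ?_⟩, fun x => ?_⟩, h⟩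
  · unfold qnorm
    congr 1
    simp only [Fin.sum_univ_two, Pi.sub_apply, Matrix.cons_val_zero, Matrix.cons_val_one,
      Real.rpow_two, sq_abs]
    have := Real.sin_sq_add_cos_sq (θ * t)
    linear_combination ((x 0 - y 0) ^ 2 + (x 1 - y 1) ^ 2) * this
  · refine Continuous.continuousOn (continuous_pi fun i => ?_)
    fin_cases i <;> simp <;> fun_prop
  · funext i
    fin_cases i <;> simp
  · rw [hasDerivWithinAt_pi]
    have hl : HasDerivAt (fun t : ℝ => θ * t) θ 0 := by
      simpa using (hasDerivAt_id (0 : ℝ)).const_mul θ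
    have hcos := hl.cos
    have hsin := hl.sin
    have hid := hasDerivAt_id (0 : ℝ)
    intro i
    apply HasDerivAt.hasDerivWithinAt
    fin_cases i
    · have := (hid.mul_const (c 0)).add ((hcos.mul_const (x 0)).sub (hsin.mul_const (x 1)))
      simp at this ⊢
      convert this using 1
      all_goals first | rfl | ring
    · have := (hid.mul_const (c 1)).add ((hsin.mul_const (x 0)).add (hcos.mul_const (x 1)))
      simp at this ⊢
      convert this using 1
      all_goals first | rfl | ring



lemma rank_comap {W : Type} (e : V ≃ W) (q : ℝ) (F : SimpleGraph W) (x : W → Fin 2 → ℝ) :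
    rigidityRank q (F.comap e) (fun v => x (e v)) = rigidityRank q F x := by
  let L : (W × Fin 2 → ℝ) ≃ₗ[ℝ] (V × Fin 2 → ℝ) :=
    LinearEquiv.funCongrLeft ℝ ℝ (e.prodCongr (Equiv.refl (Fin 2)))
  have hrow : ∀ v w, rigidityRow q (fun v => x (e v)) v w = L (rigidityRow q x (e v) (e w)) := by
    intro v w
    funext z
    simp [L, rigidityRow, LinearEquiv.funCongrLeft_apply, LinearMap.funLeft_apply]
  unfold rigidityRank
  have : {r : V × Fin 2 → ℝ | ∃ v w, (F.comap e).Adj v w ∧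
      r = rigidityRow q (fun v => x (e v)) v w} =
      L '' {r : W × Fin 2 → ℝ | ∃ v w, F.Adj v w ∧ r = rigidityRow q x v w} := by
    ext r
    constructor
    · rintro ⟨v, w, h, rfl⟩
      exact ⟨_, ⟨e v, e w, h, rfl⟩, (hrow v w).symm⟩
    · rintro ⟨_, ⟨v, w, h, rfl⟩, rfl⟩
      refine ⟨e.symm v, e.symm w, by simpa using h, ?_⟩
      rw [hrow]; simp
  rw [this]
  have h2 := Submodule.map_span (L : (W × Fin 2 → ℝ) →ₗ[ℝ] (V × Fin 2 → ℝ))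
    {r : W × Fin 2 → ℝ | ∃ v w, F.Adj v w ∧ r = rigidityRow q x v w}
  rw [LinearEquiv.coe_coe] at h2
  rw [← h2]
  exact LinearEquiv.finrank_map_eq L _

lemma regular_comap {W : Type} (e : V ≃ W) {q : ℝ} {F : SimpleGraph W} {p : W → Fin 2 → ℝ}
    (h : IsRegular q F p) : IsRegular q (F.comap e) (fun v => p (e v)) := by
  refine ⟨fun v w hvw => h.1 hvw, fun x hx => ?_⟩
  rw [rank_comap e q F p]
  have h2 := rank_comap e q F (fun w => x (e.symm w))
  simp only [Equiv.symm_apply_apply] at h2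
  rw [h2]
  refine h.2 _ fun v w hvw => hx ?_
  simpa using hvw

lemma generic_comp {W : Type} {q : ℝ} {p : W → Fin 2 → ℝ} (hp : IsGeneric q p) {f : V → W}
    (hf : Function.Injective f) : IsGeneric q (fun v => p (f v)) := by
  intro W0 hW0
  have hg := hp (f '' W0) (hW0.image f)
  refine ⟨fun a ha b hb hab => hf (hg.1 (mem_image_of_mem f ha) (mem_image_of_mem f hb) hab),
    fun W' hW' H => ?_⟩
  let e : W' ≃ (f '' W') := Equiv.Set.image f W' hf
  have h1 := regular_comap e (hg.2 (f '' W') (image_mono hW') (H.comap e.symm))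
  have h2 : (H.comap e.symm).comap e = H := by
    ext a b; simp
  rw [h2] at h1
  exact h1

lemma generic_regular [Fintype V] {q : ℝ} {p : V → Fin 2 → ℝ} (hp : IsGeneric q p)
    (F : SimpleGraph V) : IsRegular q F p := by
  let e : V ≃ (univ : Set V) := (Equiv.Set.univ V).symm
  have h1 := regular_comap e ((hp univ (toFinite _)).2 univ subset_rfl (F.comap e.symm))
  have h2 : (F.comap e.symm).comap e = F := by
    ext a b; simp
  rw [h2] at h1
  exact h1

lemma generic_inj [Fintype V] {q : ℝ} {p : V → Fin 2 → ℝ} (hp : IsGeneric q p) :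
    Function.Injective p := fun a b h => (hp univ (toFinite _)).1 trivial trivial h

lemma generic_indep [Fintype V] {q : ℝ} (hq : 1 < q) {l : ℤ} (hl : l = 3 ∨ (l = 2 ∧ q ≠ 2))
    {F : SimpleGraph V} (hs : Sparse l F) {p : V → Fin 2 → ℝ} (hp : IsGeneric q p) :
    IndepN F (Nq q p) := by
  obtain ⟨x, hx⟩ := laman' hq hl hs
  exact indepN_of_regular hx (generic_regular hp F)

/-- The edge operator. -/
def opE (F : SimpleGraph V) (N : V → V → Fin 2 → ℝ) : (V → Fin 2 → ℝ) →ₗ[ℝ] (F.edgeSet → ℝ) where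
  toFun u e := sig N u (ee F e).1 (ee F e).2
  map_add' u u' := by funext e; simp only [sig, Pi.add_apply]; ring
  map_smul' r u := by
    funext e; simp only [sig, Pi.smul_apply, smul_eq_mul, RingHom.id_apply]; ring

lemma opE_surj {F : SimpleGraph V} {N : V → V → Fin 2 → ℝ} (h : IndepN F N) :
    Function.Surjective (opE F N) := by
  intro g
  obtain ⟨u, hu⟩ := h (fun v w => if hvw : F.Adj v w then g ⟨s(v, w), hvw⟩ else 0)
    (fun v w hvw => by
      rw [dif_pos hvw, dif_pos hvw.symm]
      congr 2
      exact Sym2.eq_swap)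
  refine ⟨u, ?_⟩
  funext e
  have := hu _ _ (ee_adj F e)
  rw [dif_pos (ee_adj F e)] at this
  refine this.trans ?_
  congr 1
  exact Subtype.ext (ee_mk F e)

lemma card_edges [Fintype V] (F : SimpleGraph V) :
    2 * (Fintype.card F.edgeSet : ℤ) = dd F Finset.univ := by
  have h := F.sum_degrees_eq_twice_card_edges
  rw [dd_sum]
  have h1 : ∀ v, dg F v Finset.univ = F.degree v := fun v => by
    rw [nbrs_card, ← SimpleGraph.card_neighborFinset_eq_degree, SimpleGraph.neighborFinset_eq_filter]
  simp only [h1]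
  rw [SimpleGraph.edgeFinset_card] at h
  have h' : (∑ v, (F.degree v : ℤ)) = 2 * (Fintype.card F.edgeSet : ℤ) := by
    rw [← Nat.cast_sum, h]; push_cast; rfl
  exact h'.symm

lemma ker_finrank [Fintype V] {F : SimpleGraph V} {N : V → V → Fin 2 → ℝ} (h : IndepN F N) {l : ℤ}
    (ht : dd F Finset.univ = 4 * Fintype.card V - 2 * l) :
    (Module.finrank ℝ (LinearMap.ker (opE F N)) : ℤ) = l := by
  have h1 := LinearMap.finrank_range_add_finrank_ker (opE F N)
  rw [LinearMap.range_eq_top.2 (opE_surj h), finrank_top] at h1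
  have h2 : Module.finrank ℝ (F.edgeSet → ℝ) = Fintype.card F.edgeSet := Module.finrank_fintype_fun_eq_card ℝ
  have h3 : Module.finrank ℝ (V → Fin 2 → ℝ) = Fintype.card V * 2 := by
    rw [Module.finrank_pi_fintype]; simp
  rw [h2, h3] at h1
  have := card_edges F
  omega

lemma rig [Fintype V] {q : ℝ} (hq : 1 < q) {l : ℤ} (hl : (l = 3 ∧ q = 2) ∨ (l = 2 ∧ q ≠ 2))
    {F : SimpleGraph V} (hs : Sparse l F) (hc : 2 ≤ Fintype.card V)
    (ht : dd F Finset.univ = 4 * Fintype.card V - 2 * l) {p : V → Fin 2 → ℝ} (hp : IsGeneric q p)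
    {u : V → Fin 2 → ℝ} (hu : ∀ v w, F.Adj v w → sig (Nq q p) u v w = 0) :
    IsQTrivialOn q p univ u := by
  have hI := generic_indep hq (by tauto) hs hp
  have hk := ker_finrank hI ht
  have huk : u ∈ LinearMap.ker (opE F (Nq q p)) := by
    rw [LinearMap.mem_ker]; funext e; exact hu _ _ (ee_adj F e)
  obtain ⟨v0, w0, hvw⟩ := Fintype.exists_pair_of_one_lt_card (show 1 < Fintype.card V by omega)
  rcases hl with ⟨rfl, rfl⟩ | ⟨rfl, hq2⟩
  · let L : (Fin 3 → ℝ) →ₗ[ℝ] (V → Fin 2 → ℝ) :=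
      { toFun := fun c v => ![c 0 - c 2 * p v 1, c 1 + c 2 * p v 0]
        map_add' := fun c c' => by
          funext v i; fin_cases i <;> simp <;> ring
        map_smul' := fun r c => by
          funext v i; fin_cases i <;> simp <;> ring }
    have hLinj : Function.Injective L := by
      rw [injective_iff_map_eq_zero]
      intro c hc
      have hv := congrFun hc v0
      have hw := congrFun hc w0
      have a0 : c 0 - c 2 * p v0 1 = 0 := by simpa [L] using congrFun hv 0
      have a1 : c 1 + c 2 * p v0 0 = 0 := by simpa [L] using congrFun hv 1
      have b0 : c 0 - c 2 * p w0 1 = 0 := by simpa [L] using congrFun hw 0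
      have b1 : c 1 + c 2 * p w0 0 = 0 := by simpa [L] using congrFun hw 1
      have c2 : c 2 = 0 := by
        by_contra hne
        apply hvw
        apply generic_inj hp
        funext i
        fin_cases i
        · exact mul_left_cancel₀ hne (show c 2 * p v0 0 = c 2 * p w0 0 by linarith)
        · exact mul_left_cancel₀ hne (show c 2 * p v0 1 = c 2 * p w0 1 by linarith)
      rw [c2] at a0 a1
      funext i
      fin_cases i
      · simpa using a0
      · simpa using a1
      · simpa using c2
    have hle : LinearMap.range L ≤ LinearMap.ker (opE F (Nq 2 p)) := by
      rintro _ ⟨c, rfl⟩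
      rw [LinearMap.mem_ker]
      funext e
      exact mot hq (triv_rot ![c 0, c 1] (c 2) (fun v _ => by simp [L]) : IsQTrivialOn 2 p univ (L c))
        trivial trivial
    have heq := Submodule.eq_of_le_of_finrank_le hle (by
      rw [LinearMap.finrank_range_of_inj hLinj]
      simp; omega)
    rw [← heq] at huk
    obtain ⟨c, rfl⟩ := huk
    exact triv_rot ![c 0, c 1] (c 2) (fun v _ => by simp [L])
  · let L : (Fin 2 → ℝ) →ₗ[ℝ] (V → Fin 2 → ℝ) :=
      { toFun := fun c _ => c
        map_add' := fun c c' => rfl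
        map_smul' := fun r c => rfl }
    have hLinj : Function.Injective L := fun c c' h => congrFun h v0
    have hle : LinearMap.range L ≤ LinearMap.ker (opE F (Nq q p)) := by
      rintro _ ⟨c, rfl⟩
      rw [LinearMap.mem_ker]
      funext e
      exact mot hq (triv_const c (fun v _ => rfl) : IsQTrivialOn q p univ (L c)) trivial trivial
    have heq := Submodule.eq_of_le_of_finrank_le hle (by
      rw [LinearMap.finrank_range_of_inj hLinj]
      simp; omega)
    rw [← heq] at huk
    obtain ⟨c, rfl⟩ := huk
    exact triv_const c (fun v _ => rfl)



lemma dd_map {W : Type} [Fintype V] [Fintype W] (f : W ↪ V) (F : SimpleGraph V) (A : Finset W) :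
    dd (F.comap f) A = dd F (A.map f) := by
  rw [dd_card, dd_card]
  congr 1
  rw [← Finset.card_map (f.prodMap f)]
  congr 1
  ext ⟨a, b⟩
  simp only [Finset.mem_map, Finset.mem_filter, Finset.mem_univ, true_and, SimpleGraph.comap_adj]
  constructor
  · rintro ⟨⟨x, y⟩, ⟨h1, h2, h3⟩, h4⟩
    obtain ⟨rfl, rfl⟩ : f x = a ∧ f y = b := by simpa using h4
    exact ⟨h1, ⟨x, h2, rfl⟩, ⟨y, h3, rfl⟩⟩
  · rintro ⟨h1, ⟨x, h2, rfl⟩, ⟨y, h3, rfl⟩⟩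
    exact ⟨(x, y), ⟨h1, h2, h3⟩, rfl⟩

lemma rig_sub [Fintype V] {q : ℝ} (hq : 1 < q) {l : ℤ} (hl : (l = 3 ∧ q = 2) ∨ (l = 2 ∧ q ≠ 2))
    {F : SimpleGraph V} (hs : Sparse l F) {T : Finset V} (hT : Tight l F T)
    {p : ↥(T : Set V) → Fin 2 → ℝ} (hp : IsGeneric q p) {u : ↥(T : Set V) → Fin 2 → ℝ}
    (hu : ∀ v w : ↥(T : Set V), F.Adj v w → sig (Nq q p) u v w = 0) :
    IsQTrivialOn q p univ u := by
  let f : ↥(T : Set V) ↪ V := Function.Embedding.subtype _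
  have hcard : Fintype.card (T : Set V) = T.card := by simp
  have hmap : (Finset.univ : Finset (T : Set V)).map f = T := by
    ext x; simp [f]
  refine rig hq hl (F := F.comap f) (fun S hS => ?_) (by rw [hcard]; exact hT.1) ?_ hp
    (fun v w h => hu v w h)
  · rw [dd_map, ← Finset.card_map f]
    exact hs _ (by rwa [Finset.card_map])
  · rw [dd_map, hmap, hcard]; exact hT.2

lemma pair_blocked [Fintype V] {q : ℝ} (hq : 1 < q) {l : ℤ}
    (hl : (l = 3 ∧ q = 2) ∨ (l = 2 ∧ q ≠ 2)) {G F : SimpleGraph V} (hFG : F ≤ G)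
    (hs : Sparse l F) (hmax : ∀ F', F ≤ F' → F' ≤ G → Sparse l F' → F' ≤ F)
    {p : V → Fin 2 → ℝ} (hp : IsGeneric q p) {S : Set V}
    (hi : ∀ u, (∀ a b, G.Adj a b → sig (Nq q p) u a b = 0) → IsQTrivialOn q p S u)
    {v w : V} (hv : v ∈ S) (hw : w ∈ S) (hvw : v ≠ w) (hF : ¬ F.Adj v w) :
    ∃ T, Tight l F T ∧ v ∈ T ∧ w ∈ T := by
  have block : ∀ a b, G.Adj a b → ¬ F.Adj a b → ∃ T, Tight l F T ∧ a ∈ T ∧ b ∈ T := by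
    intro a b hG hnF
    by_contra! hcon
    refine hnF (hmax (F ⊔ SimpleGraph.edge a b) le_sup_left ?_ (sparse_edge hs hcon) ?_)
    · refine sup_le hFG fun x y hxy => ?_
      rw [SimpleGraph.edge_adj] at hxy
      rcases hxy with ⟨⟨rfl, rfl⟩ | ⟨rfl, rfl⟩, _⟩
      · exact hG
      · exact hG.symm
    · refine Or.inr ?_
      rw [SimpleGraph.edge_adj]; exact ⟨Or.inl ⟨rfl, rfl⟩, hG.ne⟩
  by_contra! hcon
  have hvwE : (SimpleGraph.edge v w).Adj v w := by
    rw [SimpleGraph.edge_adj]; exact ⟨Or.inl ⟨rfl, rfl⟩, hvw⟩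
  have hI := generic_indep hq (by tauto) (sparse_edge hs hcon) hp
  let P : V → V → Prop := fun a b => (a = v ∧ b = w) ∨ (a = w ∧ b = v)
  obtain ⟨u, hu⟩ := hI (fun a b => if P a b then 1 else 0) (fun a b _ => by
    have : P a b ↔ P b a := by simp only [P]; tauto
    simp only [this])
  have huF : ∀ a b, F.Adj a b → sig (Nq q p) u a b = 0 := by
    intro a b hab
    rw [hu a b (Or.inl hab), if_neg]
    rintro (⟨rfl, rfl⟩ | ⟨rfl, rfl⟩)
    · exact hF hab
    · exact hF hab.symm
  have huG : ∀ a b, G.Adj a b → sig (Nq q p) u a b = 0 := by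
    intro a b hab
    by_cases hFab : F.Adj a b
    · exact huF a b hFab
    obtain ⟨T, hT, ha, hb⟩ := block a b hab hFab
    have h1 := rig_sub hq hl hs hT (p := fun x => p x.1) (u := fun x => u x.1)
      (generic_comp hp Subtype.val_injective) (fun x y hxy => huF x.1 y.1 hxy)
    exact mot hq h1 (v := ⟨a, ha⟩) (w := ⟨b, hb⟩) trivial trivial
  have h0 := mot hq (hi u huG) hv hw
  rw [hu v w (Or.inr hvwE), if_pos (Or.inl ⟨rfl, rfl⟩)] at h0
  exact one_ne_zero h0

lemma all_blocked [Fintype V] {l : ℤ} {F : SimpleGraph V} (hs : Sparse l F) {S : Set V}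
    (hS : l = 3 ∨ (l = 2 ∧ 4 ≤ S.ncard))
    (h : ∀ v ∈ S, ∀ w ∈ S, v ≠ w → ¬ F.Adj v w → ∃ T, Tight l F T ∧ v ∈ T ∧ w ∈ T) :
    ∀ v ∈ S, ∀ w ∈ S, v ≠ w → ∃ T, Tight l F T ∧ v ∈ T ∧ w ∈ T := by
  intro v hv w hw hvw
  by_contra hcon
  have hadj : F.Adj v w := by
    by_contra hn; exact hcon (h v hv w hw hvw hn)
  rcases hS with rfl | ⟨rfl, hS⟩
  · have hc2 : ({v, w} : Finset V).card = 2 := Finset.card_pair hvw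
    refine hcon ⟨{v, w}, ⟨hc2.ge, le_antisymm (hs _ hc2.ge) ?_⟩, by simp, by simp⟩
    rw [hc2]; have := dd_pair F hadj; push_cast; linarith
  · -- no tight set containing `v` and another element of `S`
    have key : ∀ v ∈ S, ∀ w ∈ S, v ≠ w → (¬ ∃ T, Tight 2 F T ∧ v ∈ T ∧ w ∈ T) →
        ∀ b ∈ S, b ≠ v → b ≠ w → ¬ ∃ T, Tight 2 F T ∧ v ∈ T ∧ b ∈ T := by
      rintro v hv w hw hvw hcon b hb hbv hbw ⟨T, hT, hvT, hbT⟩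
      have hwT : w ∉ T := fun hwT => hcon ⟨T, hT, hvT, hwT⟩
      have hvw' : F.Adj v w := by
        by_contra hn; exact hcon (h v hv w hw hvw hn)
      have hbw' : F.Adj b w := by
        by_contra hn
        obtain ⟨T', hT', hbT', hwT'⟩ := h b hb w hw hbw hn
        exact hcon ⟨_, tight_union hs hT hT' (Or.inr ⟨rfl, Finset.card_pos.2 ⟨b, by simp [*]⟩⟩),
          by simp [*], by simp [*]⟩
      refine hcon ⟨insert w T, ?_, by simp [*], by simp⟩
      have hc := Finset.card_insert_of_notMem hwT
      have h2 : 2 ≤ (insert w T).card := by have := hT.1; omega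
      refine ⟨h2, le_antisymm (hs _ h2) ?_⟩
      rw [dd_insert F hwT, hc, hT.2]
      have := dg_ge F w T {v, b} (by
        intro x hx
        simp only [Finset.mem_insert, Finset.mem_singleton] at hx
        rcases hx with rfl | rfl
        · exact ⟨hvw'.symm, hvT⟩
        · exact ⟨hbw'.symm, hbT⟩)
      rw [Finset.card_pair hbv.symm] at this
      push_cast at this ⊢; linarith
    have hcon' : ¬ ∃ T, Tight 2 F T ∧ w ∈ T ∧ v ∈ T := fun ⟨T, hT, h1, h2⟩ => hcon ⟨T, hT, h2, h1⟩
    -- two more elements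
    obtain ⟨a, ha, hav, haw⟩ : ∃ a ∈ S, a ≠ v ∧ a ≠ w := by
      by_contra! hn
      have : S ⊆ {v, w} := fun x hx => by
        by_cases hxv : x = v
        · exact Or.inl hxv
        · exact Or.inr (hn x hx hxv)
      have := (ncard_le_ncard this (toFinite _)).trans (ncard_insert_le _ _)
      rw [ncard_singleton] at this
      omega
    obtain ⟨b, hb, hbv, hbw, hba⟩ : ∃ b ∈ S, b ≠ v ∧ b ≠ w ∧ b ≠ a := by
      by_contra! hn
      have : S ⊆ {v, w, a} := fun x hx => by
        by_cases hxv : x = v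
        · exact Or.inl hxv
        by_cases hxw : x = w
        · exact Or.inr (Or.inl hxw)
        · exact Or.inr (Or.inr (hn x hx hxv hxw))
      have h1 := (ncard_le_ncard this (toFinite _)).trans (ncard_insert_le _ _)
      have h2 := ncard_insert_le w {a}
      rw [ncard_singleton] at h2
      omega
    have nva := key v hv w hw hvw hcon a ha hav haw
    have nvb := key v hv w hw hvw hcon b hb hbv hbw
    have nwa := key w hw v hv hvw.symm hcon' a ha haw hav
    have nwb := key w hw v hv hvw.symm hcon' b hb hbw hbv
    have nav : ¬ ∃ T, Tight 2 F T ∧ a ∈ T ∧ v ∈ T := fun ⟨T, hT, h1, h2⟩ => nva ⟨T, hT, h2, h1⟩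
    have nab := key a ha v hv hav nav b hb hba hbv
    have adj : ∀ x ∈ S, ∀ y ∈ S, x ≠ y → (¬ ∃ T, Tight 2 F T ∧ x ∈ T ∧ y ∈ T) → F.Adj x y :=
      fun x hx y hy hxy hn => by
        by_contra hn'
        exact hn (h x hx y hy hxy hn')
    have eva := adj v hv a ha hav.symm nva
    have evb := adj v hv b hb hbv.symm nvb
    have ewa := adj w hw a ha haw.symm nwa
    have ewb := adj w hw b hb hbw.symm nwb
    have eab := adj a ha b hb hba.symm nab
    apply hcon
    have hvn : v ∉ ({w, a, b} : Finset V) := by simp [hvw, hav.symm, hbv.symm]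
    have hwn : w ∉ ({a, b} : Finset V) := by simp [haw.symm, hbw.symm]
    have hc3 : ({w, a, b} : Finset V).card = 3 :=
      Finset.card_eq_three.2 ⟨w, a, b, haw.symm, hbw.symm, hba.symm, rfl⟩
    have h1 := dd_insert F hvn
    have h2 := dd_insert F hwn
    have h3 := dd_pair F eab
    have h4 := dg_ge F v {w, a, b} {w, a, b} (by
      intro z hz
      refine ⟨?_, hz⟩
      simp only [Finset.mem_insert, Finset.mem_singleton] at hz
      rcases hz with rfl | rfl | rfl <;> assumption)
    have h5 := dg_ge F w {a, b} {a, b} (by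
      intro z hz
      refine ⟨?_, hz⟩
      simp only [Finset.mem_insert, Finset.mem_singleton] at hz
      rcases hz with rfl | rfl <;> assumption)
    rw [hc3] at h4
    rw [Finset.card_pair hba.symm] at h5
    have hc4 : (insert v ({w, a, b} : Finset V)).card = 4 := by
      rw [Finset.card_insert_of_notMem hvn, hc3]
    refine ⟨insert v {w, a, b}, ⟨by omega, le_antisymm (hs _ (by omega)) ?_⟩, by simp, by simp⟩
    rw [hc4]; push_cast at h4 h5 ⊢; linarith

lemma big_tight [Fintype V] {l : ℤ} (hl : l = 2 ∨ l = 3) {F : SimpleGraph V} (hs : Sparse l F)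
    {S : Set V} (hS : 2 ≤ S.ncard)
    (h : ∀ v ∈ S, ∀ w ∈ S, v ≠ w → ∃ T, Tight l F T ∧ v ∈ T ∧ w ∈ T) :
    ∃ T : Finset V, Tight l F T ∧ ∀ v ∈ S, v ∈ T := by
  obtain ⟨v0, hv0, w0, hw0, hne⟩ := (one_lt_ncard (toFinite S)).1 (show 1 < S.ncard by omega)
  let P : Finset (Finset V) := Finset.univ.filter fun T => Tight l F T ∧ v0 ∈ T ∧ w0 ∈ T
  obtain ⟨T, hTP, hmax⟩ := Finset.exists_max_image P Finset.card
    (by obtain ⟨T, hT⟩ := h v0 hv0 w0 hw0 hne; exact ⟨T, by simpa [P] using hT⟩)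
  simp only [P, Finset.mem_filter, Finset.mem_univ, true_and] at hTP hmax
  obtain ⟨hT, hvT, hwT⟩ := hTP
  refine ⟨T, hT, fun x hx => ?_⟩
  by_contra hxT
  have hxv : x ≠ v0 := fun h => hxT (h ▸ hvT)
  have hxw : x ≠ w0 := fun h => hxT (h ▸ hwT)
  obtain ⟨A, hA, hxA, hvA⟩ := h x hx v0 hv0 hxv
  obtain ⟨B, hB, hwB, hxB⟩ := h w0 hw0 x hx hxw.symm
  obtain ⟨U, hU, hvU, hwU, hxU⟩ := tri hl hs hxv.symm hT hB hA hvT hwT hwB hxB hxA hvA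
  have h2 : 2 ≤ (T ∩ U).card := by
    rw [← Finset.card_pair hne]
    apply Finset.card_le_card
    intro z; simp only [Finset.mem_insert, Finset.mem_singleton]
    rintro (rfl | rfl) <;> simp [*]
  have h3 := hmax (T ∪ U) ⟨tight_union hs hT hU (Or.inl h2), by simp [*], by simp [*]⟩
  have h4 : T.card < (T ∪ U).card := Finset.card_lt_card
    ⟨Finset.subset_union_left, fun hsub => hxT (hsub (by simp [hxU]))⟩
  omega

lemma exists_max_sparse [Fintype V] {l : ℤ} (hl : l ≤ 4) (G : SimpleGraph V) :
    ∃ F, F ≤ G ∧ Sparse l F ∧ ∀ F', F ≤ F' → F' ≤ G → Sparse l F' → F' ≤ F := by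
  let P : Set (SimpleGraph V) := {F | F ≤ G ∧ Sparse l F}
  have hne : P.Nonempty := ⟨⊥, bot_le, fun S hS => by
    have : dd (⊥ : SimpleGraph V) S = 0 := by
      unfold dd
      exact Finset.sum_eq_zero fun v _ => Finset.sum_eq_zero fun w _ => if_neg (fun h => h.1)
    omega⟩
  obtain ⟨F, hF⟩ := (toFinite P).exists_maximal hne
  exact ⟨F, hF.1.1, hF.1.2, fun F' h1 h2 h3 => hF.2 ⟨h2, h3⟩ h1⟩


end helpers

theorem statement_4 {V : Type} [Fintype V] (G : SimpleGraph V) (H : G.Subgraph)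
    {q : ℝ} (hq : 1 < q)
    (hcase : (q = 2 ∧ 2 ≤ H.verts.ncard) ∨ (q ≠ 2 ∧ 4 ≤ H.verts.ncard)) :
    (∀ p : V → Fin 2 → ℝ, IsGeneric q p →
        ∀ u, IsQFlex q H.spanningCoe p u →
          (∃ u', IsQFlex q G p u' ∧ ∀ v ∈ H.verts, u' v = u v) →
          IsQTrivialOn q p H.verts u) ↔
      ∃ H' : G.Subgraph, H ≤ H' ∧ Rigid q 2 H'.coe := by
  constructor
  · intro hi
    by_cases hex : ∃ p : V → Fin 2 → ℝ, IsGeneric q p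
    swap
    · refine ⟨⊤, le_top, fun p' hp' => absurd ⟨_, generic_comp hp' (f := fun v : V => ⟨v, trivial⟩)
        fun a b hab => congrArg Subtype.val hab⟩ hex⟩
    obtain ⟨p, hp⟩ := hex
    obtain ⟨l, hl, hlS⟩ : ∃ l : ℤ, ((l = 3 ∧ q = 2) ∨ (l = 2 ∧ q ≠ 2)) ∧
        ((l = 3 ∧ 2 ≤ H.verts.ncard) ∨ (l = 2 ∧ 4 ≤ H.verts.ncard)) := by
      rcases hcase with ⟨h1, h2⟩ | ⟨h1, h2⟩
      · exact ⟨3, Or.inl ⟨rfl, h1⟩, Or.inl ⟨rfl, h2⟩⟩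
      · exact ⟨2, Or.inr ⟨rfl, h1⟩, Or.inr ⟨rfl, h2⟩⟩
    obtain ⟨F, hFG, hs, hmax⟩ := exists_max_sparse (l := l) (by omega) G
    have hinj := generic_inj hp
    have hi' : ∀ u, (∀ a b, G.Adj a b → sig (Nq q p) u a b = 0) → IsQTrivialOn q p H.verts u := by
      intro u hu
      have hG : IsQFlex q G p u := fun a b hab =>
        (flex_iff hq (fun h => hab.ne (hinj h))).2 (hu a b hab)
      exact hi p hp u (fun a b hab => hG (H.adj_sub hab)) ⟨u, hG, fun _ _ => rfl⟩
    have h1 := all_blocked hs (S := H.verts) (by omega) fun v hv w hw hvw hF =>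
      pair_blocked hq hl hFG hs hmax hp hi' hv hw hvw hF
    obtain ⟨T, hT, hTS⟩ := big_tight (by omega) hs (by omega) h1
    refine ⟨(⊤ : G.Subgraph).induce (T : Set V), ⟨fun v hv => hTS v hv, fun a b hab =>
      ⟨hTS a (H.edge_vert hab), hTS b (H.edge_vert hab.symm), H.adj_sub hab⟩⟩, ?_⟩
    intro p' hp' u hu
    refine rig_sub hq hl hs hT hp' fun v w hvw => ?_
    have hne : p' v ≠ p' w := by
      intro h
      exact hvw.ne (congrArg Subtype.val ((hp' univ (toFinite _)).1 trivial trivial h))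
    exact (flex_iff hq hne).1 (hu ⟨v.2, w.2, hFG hvw⟩)
  · rintro ⟨H', hH, hR⟩ p hp u _ ⟨u', hu', heq⟩
    have hp' := generic_comp hp (f := fun v : H'.verts => v.1) Subtype.val_injective
    obtain ⟨γ, hγ, h⟩ := hR _ hp' (fun v => u' v.1) fun a b hab => hu' (H'.adj_sub hab)
    exact ⟨γ, hγ, fun v hv => by rw [← heq v hv]; exact h ⟨v, hH.1 hv⟩ trivial⟩

end RigidityPaper
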